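/- Let Ω ⊂ ℝ^d (d ≥ 2) be a bounded domain, let I be an open interval of ℝ, and let a ∈ C^∞(Ω×I, ℝ) and b ∈ C^∞(Ω×I, ℝ^d) be bounded. Let v = v(x,t) be a solution of ∂_t v = Δ_x v + a v + b·∇_x v on Ω×I, continuous up to ∂Ω with v = 0 on ∂Ω×I, of class C^∞ in (x,t), and assume there is no t ∈ I with v(·,t) ≡ 0 on Ω. Then the set {x₀ ∈ Ω : there exists no t ∈ I such that v(x₀,t) = 0 and ∇_x v(x₀,t) = 0} is generic (residual) in Ω. -/

import Mathlib

open Set MeasureTheory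

/-- The partial derivative of `f` in the `i`-th coordinate direction. -/
noncomputable def pd {d : ℕ} (i : Fin d) (f : (Fin d → ℝ) → ℝ) (x : Fin d → ℝ) : ℝ :=
  fderiv ℝ f x (Pi.single i 1)

/-- The Laplacian of `f`. -/
noncomputable def lap {d : ℕ} (f : (Fin d → ℝ) → ℝ) (x : Fin d → ℝ) : ℝ :=
  ∑ i, pd i (pd i f) x

section

open scoped ContDiff Topology
open Filter

namespace Nodal

/-- Space-time. -/
abbrev ST (d : ℕ) := (Fin d → ℝ) × ℝ

/-- Coordinate directions; `none` is time. -/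
noncomputable def bas {d : ℕ} : Option (Fin d) → ST d
  | some i => (Pi.single i 1, 0)
  | none => (0, 1)

/-- Coordinate derivative on space-time. -/
noncomputable def Dd {d : ℕ} (o : Option (Fin d)) (f : ST d → ℝ) : ST d → ℝ :=
  fun q => fderiv ℝ f q (bas o)

section basic
variable {d : ℕ} {P : Set (ST d)} {f g : ST d → ℝ} {q : ST d}

theorem Dd_smooth (hP : IsOpen P) (hf : ContDiffOn ℝ ∞ f P) (o : Option (Fin d)) :
    ContDiffOn ℝ ∞ (Dd o f) P := by
  have h := hf.fderiv_of_isOpen (m := ∞) hP (by simp)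
  exact h.clm_apply contDiffOn_const

theorem smooth_diffAt (hP : IsOpen P) (hf : ContDiffOn ℝ ∞ f P) (hq : q ∈ P) :
    DifferentiableAt ℝ f q :=
  (hf.contDiffAt (hP.mem_nhds hq)).differentiableAt (by simp)

theorem Dd_congr (hP : IsOpen P) (h : EqOn f g P) (o : Option (Fin d)) :
    EqOn (Dd o f) (Dd o g) P := by
  intro q hq
  have : f =ᶠ[𝓝 q] g := Filter.eventuallyEq_of_mem (hP.mem_nhds hq) h
  simp only [Dd, this.fderiv_eq]

theorem Dd_comm (hP : IsOpen P) (hf : ContDiffOn ℝ ∞ f P) (o o' : Option (Fin d)) :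
    EqOn (Dd o (Dd o' f)) (Dd o' (Dd o f)) P := by
  intro q hq
  have hc := hf.contDiffAt (hP.mem_nhds hq)
  have hs : IsSymmSndFDerivAt ℝ f q := hc.isSymmSndFDerivAt (by simp; exact WithTop.coe_le_coe.2 le_top)
  have hd : DifferentiableAt ℝ (fderiv ℝ f) q :=
    (hc.fderiv_right (m := ∞) (by simp)).differentiableAt (by simp)
  have key : ∀ u w : ST d, fderiv ℝ (fun p => fderiv ℝ f p u) q w = fderiv ℝ (fderiv ℝ f) q w u := by
    intro u w
    rw [fderiv_clm_apply hd (differentiableAt_const u)]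
    simp
  show fderiv ℝ (fun p => fderiv ℝ f p (bas o')) q (bas o) =
    fderiv ℝ (fun p => fderiv ℝ f p (bas o)) q (bas o')
  rw [key, key]
  exact hs _ _

theorem Dd_add (hP : IsOpen P) (hf : ContDiffOn ℝ ∞ f P) (hg : ContDiffOn ℝ ∞ g P)
    (o : Option (Fin d)) :
    EqOn (Dd o (fun p => f p + g p)) (fun p => Dd o f p + Dd o g p) P := by
  intro q hq
  simp only [Dd]
  rw [fderiv_fun_add (smooth_diffAt hP hf hq) (smooth_diffAt hP hg hq)]
  simp

theorem Dd_mul (hP : IsOpen P) (hf : ContDiffOn ℝ ∞ f P) (hg : ContDiffOn ℝ ∞ g P)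
    (o : Option (Fin d)) :
    EqOn (Dd o (fun p => f p * g p)) (fun p => Dd o f p * g p + f p * Dd o g p) P := by
  intro q hq
  simp only [Dd]
  rw [fderiv_fun_mul (smooth_diffAt hP hf hq) (smooth_diffAt hP hg hq)]
  simp
  ring

theorem fderiv_decomp (L : ST d →L[ℝ] ℝ) (h : ST d) :
    L h = ∑ i, h.1 i * L (bas (some i)) + h.2 * L (bas none) := by
  have h1 : h = ∑ i, h.1 i • (bas (some i) : ST d) + h.2 • bas none := by
    apply Prod.ext
    · simp only [bas, Prod.fst_add, Prod.fst_sum, Prod.smul_mk]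
      ext j
      simp [Finset.sum_apply, Pi.single_apply]
    · simp [bas, Prod.snd_sum]
  conv_lhs => rw [h1]
  simp [map_sum]

/-- relation with slices -/
theorem pd_eq (v : (Fin d → ℝ) → ℝ → ℝ) (x : Fin d → ℝ) (t : ℝ) (i : Fin d)
    (h : DifferentiableAt ℝ (fun q : ST d => v q.1 q.2) (x, t)) :
    pd i (fun y => v y t) x = Dd (some i) (fun q : ST d => v q.1 q.2) (x, t) := by
  have h2 : HasFDerivAt (fun y : Fin d → ℝ => ((y, t) : ST d))
      (ContinuousLinearMap.inl ℝ (Fin d → ℝ) ℝ) x := by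
    simpa using (hasFDerivAt_prodMk_left (𝕜 := ℝ) x t)
  have h3 := (h.hasFDerivAt.comp x h2)
  have h4 : (fun y => v y t) = ((fun q : ST d => v q.1 q.2) ∘ fun y => (y, t)) := rfl
  rw [pd, h4, h3.fderiv]
  simp [Dd, bas]

theorem deriv_eq (v : (Fin d → ℝ) → ℝ → ℝ) (x : Fin d → ℝ) (t : ℝ)
    (h : DifferentiableAt ℝ (fun q : ST d => v q.1 q.2) (x, t)) :
    deriv (v x) t = Dd none (fun q : ST d => v q.1 q.2) (x, t) := by
  have h2 : HasFDerivAt (fun s : ℝ => ((x, s) : ST d))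
      (ContinuousLinearMap.inr ℝ (Fin d → ℝ) ℝ) t := by
    simpa using (hasFDerivAt_prodMk_right (𝕜 := ℝ) x t)
  have h3 := (h.hasFDerivAt.comp t h2).hasDerivAt
  have h4 : v x = ((fun q : ST d => v q.1 q.2) ∘ fun s => (x, s)) := rfl
  rw [h4, h3.deriv]
  simp [Dd, bas]

theorem lap_eq (hP : IsOpen P) (v : (Fin d → ℝ) → ℝ → ℝ)
    (hv : ContDiffOn ℝ ∞ (fun q : ST d => v q.1 q.2) P) (x : Fin d → ℝ) (t : ℝ)
    (hxt : (x, t) ∈ P) :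
    lap (fun y => v y t) x =
      ∑ i, Dd (some i) (Dd (some i) (fun q : ST d => v q.1 q.2)) (x, t) := by
  unfold lap
  refine Finset.sum_congr rfl fun i _ => ?_
  have hn : ∀ᶠ y in 𝓝 x, (y, t) ∈ P := by
    have : Continuous fun y : Fin d → ℝ => ((y, t) : ST d) := by fun_prop
    exact this.continuousAt.eventually (hP.mem_nhds hxt)
  have h1 : pd i (fun y => v y t) =ᶠ[𝓝 x]
      fun y => Dd (some i) (fun q : ST d => v q.1 q.2) (y, t) := by
    filter_upwards [hn] with y hy
    exact pd_eq v y t i (smooth_diffAt hP hv hy)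
  have h2 : pd i (pd i (fun y => v y t)) x =
      pd i (fun y => Dd (some i) (fun q : ST d => v q.1 q.2) (y, t)) x := by
    unfold pd at h1 ⊢
    rw [h1.fderiv_eq]
  rw [h2]
  exact pd_eq (fun y t => Dd (some i) (fun q : ST d => v q.1 q.2) (y, t)) x t i
    (smooth_diffAt hP (Dd_smooth hP hv _) hxt)

end basic

/-- Vanishing to order at least `k`. -/
def Ord {d : ℕ} : ℕ → (ST d → ℝ) → ST d → Prop
  | 0, _, _ => True
  | k + 1, f, p => f p = 0 ∧ ∀ o, Ord k (Dd o f) p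

/-- Iterated coordinate derivatives. -/
noncomputable def Dw {d : ℕ} : List (Option (Fin d)) → (ST d → ℝ) → ST d → ℝ
  | [], f => f
  | o :: l, f => Dd o (Dw l f)

section ord
variable {d : ℕ} {P : Set (ST d)} {f g : ST d → ℝ} {p : ST d}

theorem Dw_append (l : List (Option (Fin d))) (o : Option (Fin d)) (f : ST d → ℝ) :
    Dw (l ++ [o]) f = Dw l (Dd o f) := by
  induction l with
  | nil => rfl
  | cons a l ih => simp only [List.cons_append, Dw, ih]

theorem Dw_smooth (hP : IsOpen P) (hf : ContDiffOn ℝ ∞ f P) (l : List (Option (Fin d))) :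
    ContDiffOn ℝ ∞ (Dw l f) P := by
  induction l with
  | nil => exact hf
  | cons a l ih => exact Dd_smooth hP ih a

theorem Dw_congr (hP : IsOpen P) (h : EqOn f g P) (l : List (Option (Fin d))) :
    EqOn (Dw l f) (Dw l g) P := by
  induction l with
  | nil => exact h
  | cons a l ih => exact Dd_congr hP ih a

theorem Dw_Dd_comm (hP : IsOpen P) (hf : ContDiffOn ℝ ∞ f P) (l : List (Option (Fin d)))
    (o : Option (Fin d)) : EqOn (Dw l (Dd o f)) (Dd o (Dw l f)) P := by
  induction l with
  | nil => exact fun _ _ => rfl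
  | cons a l ih =>
    intro q hq
    show Dd a (Dw l (Dd o f)) q = Dd o (Dd a (Dw l f)) q
    rw [Dd_congr hP ih a hq]
    exact Dd_comm hP (Dw_smooth hP hf l) _ _ hq

theorem Dw_add (hP : IsOpen P) (hf : ContDiffOn ℝ ∞ f P) (hg : ContDiffOn ℝ ∞ g P)
    (l : List (Option (Fin d))) :
    EqOn (Dw l (fun q => f q + g q)) (fun q => Dw l f q + Dw l g q) P := by
  induction l with
  | nil => exact fun _ _ => rfl
  | cons a l ih =>
    intro q hq
    show Dd a (Dw l _) q = _
    rw [Dd_congr hP ih a hq]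
    exact Dd_add hP (Dw_smooth hP hf l) (Dw_smooth hP hg l) a hq

theorem Dd_zero (o : Option (Fin d)) : Dd o (fun _ => 0) = fun _ => 0 := by
  funext q; simp [Dd]

theorem Dw_zero (l : List (Option (Fin d))) : Dw l (fun _ => 0) = fun _ => 0 := by
  induction l with
  | nil => rfl
  | cons a l ih => simp only [Dw, ih, Dd_zero]

theorem Dw_sum (hP : IsOpen P) {ι : Type*} (s : Finset ι) (F : ι → ST d → ℝ)
    (hF : ∀ i, ContDiffOn ℝ ∞ (F i) P) (l : List (Option (Fin d))) :
    EqOn (Dw l (fun q => ∑ i ∈ s, F i q)) (fun q => ∑ i ∈ s, Dw l (F i) q) P := by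
  classical
  induction s using Finset.induction_on with
  | empty => simp [Dw_zero]; exact fun _ _ => rfl
  | insert a s ha ih =>
    intro q hq
    have h1 : (fun q => ∑ i ∈ insert a s, F i q) = fun q => F a q + ∑ i ∈ s, F i q := by
      funext q; rw [Finset.sum_insert ha]
    simp only [Finset.sum_insert ha]
    rw [Dw_add hP (hF a) (ContDiffOn.sum fun i _ => hF i) l hq]
    simp only [ih hq]

theorem Ord_mono_succ {k : ℕ} : ∀ {f : ST d → ℝ}, Ord (k + 1) f p → Ord k f p := by
  induction k with
  | zero => intro f _; trivial
  | succ k ih => intro f h; exact ⟨h.1, fun o => ih (h.2 o)⟩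

theorem Ord_mono {k m : ℕ} (hkm : k ≤ m) (h : Ord m f p) : Ord k f p := by
  induction hkm with
  | refl => exact h
  | step _ ih => exact ih (Ord_mono_succ h)

theorem Ord_congr (hP : IsOpen P) (hp : p ∈ P) {k : ℕ} : ∀ {f g : ST d → ℝ}, EqOn f g P →
    Ord k f p → Ord k g p := by
  induction k with
  | zero => intros; trivial
  | succ k ih =>
    intro f g h hf
    exact ⟨by rw [← h hp]; exact hf.1, fun o => ih (Dd_congr hP h o) (hf.2 o)⟩

theorem Ord_add (hP : IsOpen P) (hp : p ∈ P) {k : ℕ} : ∀ {f g : ST d → ℝ},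
    ContDiffOn ℝ ∞ f P → ContDiffOn ℝ ∞ g P → Ord k f p → Ord k g p →
    Ord k (fun q => f q + g q) p := by
  induction k with
  | zero => intros; trivial
  | succ k ih =>
    intro f g hf hg h1 h2
    refine ⟨by simp [h1.1, h2.1], fun o => ?_⟩
    exact Ord_congr hP hp (Dd_add hP hf hg o).symm
      (ih (Dd_smooth hP hf o) (Dd_smooth hP hg o) (h1.2 o) (h2.2 o))

theorem Ord_zero_fun {k : ℕ} : Ord k (fun _ => 0) p := by
  induction k with
  | zero => trivial
  | succ k ih => exact ⟨rfl, fun o => by rw [Dd_zero]; exact ih⟩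

theorem Ord_sum (hP : IsOpen P) (hp : p ∈ P) {k : ℕ} {ι : Type*} (s : Finset ι)
    (F : ι → ST d → ℝ) (hF : ∀ i, ContDiffOn ℝ ∞ (F i) P) (h : ∀ i, Ord k (F i) p) :
    Ord k (fun q => ∑ i ∈ s, F i q) p := by
  classical
  induction s using Finset.induction_on with
  | empty => simpa using Ord_zero_fun
  | insert a s ha ih =>
    simp only [Finset.sum_insert ha]
    exact Ord_add hP hp (hF a) (ContDiffOn.sum fun i _ => hF i) (h a) ih

theorem Ord_mul (hP : IsOpen P) (hp : p ∈ P) {k : ℕ} : ∀ {f g : ST d → ℝ},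
    ContDiffOn ℝ ∞ f P → ContDiffOn ℝ ∞ g P → Ord k g p →
    Ord k (fun q => f q * g q) p := by
  induction k with
  | zero => intros; trivial
  | succ k ih =>
    intro f g hf hg h2
    refine ⟨by simp [h2.1], fun o => ?_⟩
    refine Ord_congr hP hp (Dd_mul hP hf hg o).symm ?_
    exact Ord_add hP hp ((Dd_smooth hP hf o).mul hg) (hf.mul (Dd_smooth hP hg o))
      (ih (Dd_smooth hP hf o) hg (Ord_mono_succ h2)) (ih hf (Dd_smooth hP hg o) (h2.2 o))

theorem Ord_iff_Dw {k : ℕ} : ∀ {f : ST d → ℝ},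
    Ord k f p ↔ ∀ l : List (Option (Fin d)), l.length < k → Dw l f p = 0 := by
  induction k with
  | zero => intro f; simp [Ord]
  | succ k ih =>
    intro f
    constructor
    · intro h l hl
      rcases List.eq_nil_or_concat l with rfl | ⟨l', o, rfl⟩
      · exact h.1
      · rw [List.concat_eq_append, Dw_append]
        exact (ih.1 (h.2 o)) l' (by simp at hl; omega)
    · intro h
      refine ⟨h [] (by simp), fun o => ih.2 fun l hl => ?_⟩
      rw [← Dw_append]
      exact h _ (by simp; omega)

/-- Flatness along an open subset of a time slice. -/
def Flat (U : Set (Fin d → ℝ)) (t₀ : ℝ) : ℕ → (ST d → ℝ) → Prop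
  | 0, _ => True
  | m + 1, f => (∀ x ∈ U, f (x, t₀) = 0) ∧ Flat U t₀ m (Dd none f)

variable {U : Set (Fin d → ℝ)} {t₀ : ℝ}

theorem Flat_mono_succ {m : ℕ} : ∀ {f : ST d → ℝ}, Flat U t₀ (m + 1) f → Flat U t₀ m f := by
  induction m with
  | zero => intro f _; trivial
  | succ m ih => intro f h; exact ⟨h.1, ih h.2⟩

theorem Flat_congr (hP : IsOpen P) (hU : ∀ x ∈ U, (x, t₀) ∈ P) {m : ℕ} : ∀ {f g : ST d → ℝ},
    EqOn f g P → Flat U t₀ m f → Flat U t₀ m g := by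
  induction m with
  | zero => intros; trivial
  | succ k ih =>
    intro f g h hf
    exact ⟨fun x hx => by rw [← h (hU x hx)]; exact hf.1 x hx, ih (Dd_congr hP h none) hf.2⟩

theorem Flat_add (hP : IsOpen P) (hU : ∀ x ∈ U, (x, t₀) ∈ P) {m : ℕ} : ∀ {f g : ST d → ℝ},
    ContDiffOn ℝ ∞ f P → ContDiffOn ℝ ∞ g P → Flat U t₀ m f → Flat U t₀ m g →
    Flat U t₀ m (fun q => f q + g q) := by
  induction m with
  | zero => intros; trivial
  | succ k ih =>
    intro f g hf hg h1 h2
    refine ⟨fun x hx => by simp [h1.1 x hx, h2.1 x hx], ?_⟩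
    exact Flat_congr hP hU (Dd_add hP hf hg none).symm
      (ih (Dd_smooth hP hf none) (Dd_smooth hP hg none) h1.2 h2.2)

theorem Flat_zero_fun {m : ℕ} : Flat U t₀ m (fun _ => 0) := by
  induction m with
  | zero => trivial
  | succ k ih => exact ⟨fun _ _ => rfl, by rw [Dd_zero]; exact ih⟩

theorem Flat_sum (hP : IsOpen P) (hU : ∀ x ∈ U, (x, t₀) ∈ P) {m : ℕ} {ι : Type*} (s : Finset ι)
    (F : ι → ST d → ℝ) (hF : ∀ i, ContDiffOn ℝ ∞ (F i) P) (h : ∀ i, Flat U t₀ m (F i)) :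
    Flat U t₀ m (fun q => ∑ i ∈ s, F i q) := by
  classical
  induction s using Finset.induction_on with
  | empty => simpa using Flat_zero_fun
  | insert a s ha ih =>
    simp only [Finset.sum_insert ha]
    exact Flat_add hP hU (hF a) (ContDiffOn.sum fun i _ => hF i) (h a) ih

theorem Flat_mul (hP : IsOpen P) (hU : ∀ x ∈ U, (x, t₀) ∈ P) {m : ℕ} : ∀ {f g : ST d → ℝ},
    ContDiffOn ℝ ∞ f P → ContDiffOn ℝ ∞ g P → Flat U t₀ m g →
    Flat U t₀ m (fun q => f q * g q) := by
  induction m with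
  | zero => intros; trivial
  | succ k ih =>
    intro f g hf hg h2
    refine ⟨fun x hx => by simp [h2.1 x hx], ?_⟩
    refine Flat_congr hP hU (Dd_mul hP hf hg none).symm ?_
    exact Flat_add hP hU ((Dd_smooth hP hf none).mul hg) (hf.mul (Dd_smooth hP hg none))
      (ih (Dd_smooth hP hf none) hg (Flat_mono_succ h2)) (ih hf (Dd_smooth hP hg none) h2.2)

theorem Flat_space (hP : IsOpen P) (hUo : IsOpen U) (hU : ∀ x ∈ U, (x, t₀) ∈ P) {m : ℕ} (i : Fin d) :
    ∀ {f : ST d → ℝ}, ContDiffOn ℝ ∞ f P → Flat U t₀ m f → Flat U t₀ m (Dd (some i) f) := by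
  induction m with
  | zero => intros; trivial
  | succ k ih =>
    intro f hf h
    refine ⟨fun x hx => ?_, ?_⟩
    · rw [← pd_eq (fun y s => f (y, s)) x t₀ i (smooth_diffAt hP hf (hU x hx))]
      have : (fun y => f (y, t₀)) =ᶠ[𝓝 x] fun _ => 0 := by
        filter_upwards [hUo.mem_nhds hx] with y hy using h.1 y hy
      simp [pd, this.fderiv_eq]
    · exact Flat_congr hP hU (Dd_comm hP hf _ _) (ih (Dd_smooth hP hf none) h.2)

theorem Flat_Ord (hP : IsOpen P) (hUo : IsOpen U) (hU : ∀ x ∈ U, (x, t₀) ∈ P) {x : Fin d → ℝ}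
    (hx : x ∈ U) {m : ℕ} :
    ∀ {f : ST d → ℝ}, ContDiffOn ℝ ∞ f P → Flat U t₀ m f → Ord m f (x, t₀) := by
  induction m with
  | zero => intros; trivial
  | succ k ih =>
    intro f hf h
    refine ⟨h.1 x hx, fun o => ?_⟩
    cases o with
    | none => exact ih (Dd_smooth hP hf _) h.2
    | some i =>
      exact ih (Dd_smooth hP hf _) (Flat_mono_succ (Flat_space hP hUo hU i hf h))

/-- A solution vanishing on an open part of a time slice vanishes there to infinite order. -/
theorem flat_of_slice (hP : IsOpen P) (hUo : IsOpen U) (hU : ∀ x ∈ U, (x, t₀) ∈ P)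
    {V A : ST d → ℝ} {B : Fin d → ST d → ℝ} (hV : ContDiffOn ℝ ∞ V P) (hA : ContDiffOn ℝ ∞ A P)
    (hB : ∀ i, ContDiffOn ℝ ∞ (B i) P)
    (heq : ∀ q ∈ P, Dd none V q = ∑ i, Dd (some i) (Dd (some i) V) q + A q * V q
      + ∑ i, B i q * Dd (some i) V q)
    (h0 : ∀ x ∈ U, V (x, t₀) = 0) {x : Fin d → ℝ} (hx : x ∈ U) (m : ℕ) : Ord m V (x, t₀) := by
  refine Flat_Ord hP hUo hU hx hV ?_
  induction m with
  | zero => trivial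
  | succ m ih =>
    refine ⟨h0, ?_⟩
    have h1 := Flat_sum hP hU Finset.univ (fun i => Dd (some i) (Dd (some i) V))
      (fun i => Dd_smooth hP (Dd_smooth hP hV _) _)
      (fun i => Flat_space hP hUo hU i (Dd_smooth hP hV _) (Flat_space hP hUo hU i hV ih))
    have h2 := Flat_mul hP hU hA hV ih
    have h3 := Flat_sum hP hU Finset.univ (fun i q => B i q * Dd (some i) V q)
      (fun i => (hB i).mul (Dd_smooth hP hV _))
      (fun i => Flat_mul hP hU (hB i) (Dd_smooth hP hV _) (Flat_space hP hUo hU i hV ih))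
    have s1 : ContDiffOn ℝ ∞ (fun q => ∑ i, Dd (some i) (Dd (some i) V) q) P :=
      ContDiffOn.sum fun i _ => Dd_smooth hP (Dd_smooth hP hV _) _
    have s3 : ContDiffOn ℝ ∞ (fun q => ∑ i, B i q * Dd (some i) V q) P :=
      ContDiffOn.sum fun i _ => (hB i).mul (Dd_smooth hP hV _)
    refine Flat_congr hP hU ?_ (Flat_add hP hU (s1.add (hA.mul hV)) s3
      (Flat_add hP hU s1 (hA.mul hV) h1 h2) h3)
    intro q hq
    exact (heq q hq).symm

/-- Finite order vanishing gives a power bound. -/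
theorem Ord_bound (hP : IsOpen P) (hp : p ∈ P) {k : ℕ} : ∀ {f : ST d → ℝ},
    ContDiffOn ℝ ∞ f P → Ord k f p →
    ∃ C r : ℝ, 0 ≤ C ∧ 0 < r ∧ Metric.ball p r ⊆ P ∧
      ∀ q ∈ Metric.ball p r, |f q| ≤ C * ‖q - p‖ ^ k := by
  obtain ⟨r0, hr0, hr0P⟩ := Metric.isOpen_iff.1 hP p hp
  induction k with
  | zero =>
    intro f hf _
    have hc : ContinuousAt f p := (smooth_diffAt hP hf hp).continuousAt
    obtain ⟨r, hr, h⟩ := Metric.continuousAt_iff.1 hc 1 one_pos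
    refine ⟨|f p| + 1, min r r0, by positivity, lt_min hr hr0,
      (Metric.ball_subset_ball (min_le_right _ _)).trans hr0P, fun q hq => ?_⟩
    have := h (lt_of_lt_of_le hq (min_le_left _ _))
    rw [Real.dist_eq] at this
    have h2 := abs_sub_abs_le_abs_sub (f q) (f p)
    simp; linarith
  | succ k ih =>
    intro f hf h
    choose C r hC hr hrP hb using fun o => ih (Dd_smooth hP hf o) (h.2 o)
    obtain ⟨R, hR, hRr⟩ : ∃ R > 0, ∀ o, R ≤ r o :=
      ⟨Finset.univ.inf' Finset.univ_nonempty r,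
        by rw [gt_iff_lt, Finset.lt_inf'_iff]; exact fun o _ => hr o,
        fun o => Finset.inf'_le _ (Finset.mem_univ o)⟩
    have hRP : Metric.ball p R ⊆ P := (Metric.ball_subset_ball (hRr none)).trans (hrP none)
    refine ⟨∑ o, C o, R, Finset.sum_nonneg fun o _ => hC o, hR, hRP, fun q hq => ?_⟩
    have hconv : Convex ℝ (Metric.closedBall p ‖q - p‖) := convex_closedBall _ _
    have hsub : Metric.closedBall p ‖q - p‖ ⊆ Metric.ball p R := by
      apply Metric.closedBall_subset_ball
      rwa [← dist_eq_norm]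
    have := hconv.norm_image_sub_le_of_norm_fderiv_le (𝕜 := ℝ) (f := f) (C := (∑ o, C o) * ‖q - p‖ ^ k)
      (fun y hy => smooth_diffAt hP hf (hRP (hsub hy))) ?_
      (Metric.mem_closedBall_self (norm_nonneg _))
      (show q ∈ _ by rw [Metric.mem_closedBall, dist_eq_norm])
    · rw [h.1, sub_zero, Real.norm_eq_abs] at this
      rw [pow_succ, ← mul_assoc]; exact this
    · intro y hy
      have hyR := hsub hy
      rw [Metric.mem_closedBall, dist_eq_norm] at hy
      refine ContinuousLinearMap.opNorm_le_bound _ (by have := Finset.sum_nonneg fun o (_ : o ∈ Finset.univ) => hC o; positivity) fun z => ?_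
      rw [fderiv_decomp]
      have hbd : ∀ o, |fderiv ℝ f y (bas o)| ≤ C o * ‖q - p‖ ^ k := fun o =>
        (hb o y (Metric.ball_subset_ball (hRr o) hyR)).trans (by have := hC o; gcongr)
      have hz1 : ∀ i, |z.1 i| ≤ ‖z‖ := fun i =>
        (norm_le_pi_norm z.1 i).trans (norm_fst_le z)
      have hz2 : |z.2| ≤ ‖z‖ := norm_snd_le z
      rw [Fintype.sum_option, Real.norm_eq_abs]
      refine (abs_add_le _ _).trans ?_
      have e1 : |∑ i, z.1 i * fderiv ℝ f y (bas (some i))| ≤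
          ∑ i, ‖z‖ * (C (some i) * ‖q - p‖ ^ k) := by
        refine (Finset.abs_sum_le_sum_abs _ _).trans (Finset.sum_le_sum fun i _ => ?_)
        rw [abs_mul]
        exact mul_le_mul (hz1 i) (hbd _) (abs_nonneg _) (norm_nonneg _)
      have e2 : |z.2 * fderiv ℝ f y (bas none)| ≤ ‖z‖ * (C none * ‖q - p‖ ^ k) := by
        rw [abs_mul]
        exact mul_le_mul hz2 (hbd _) (abs_nonneg _) (norm_nonneg _)
      refine (add_le_add e1 e2).trans (le_of_eq ?_)
      rw [← Finset.mul_sum, ← Finset.sum_mul]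
      ring

end ord
end Nodal


open scoped ContDiff Topology
open Filter

namespace Nodal
section gauss
variable {d : ℕ}

/-- Squared Euclidean norm. -/
def sq (x : Fin d → ℝ) : ℝ := ∑ i, x i ^ 2

theorem sq_nonneg' (x : Fin d → ℝ) : 0 ≤ sq x := Finset.sum_nonneg fun _ _ => sq_nonneg _

/-- Gaussian weight. -/
noncomputable def Gw (t : ℝ) (x : Fin d → ℝ) : ℝ :=
  Real.exp (-((d : ℝ) / 2) * Real.log t - sq x / (4 * t))

theorem Gw_pos (t : ℝ) (x : Fin d → ℝ) : 0 < Gw t x := Real.exp_pos _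

theorem sq_contDiff {n : WithTop ℕ∞} : ContDiff ℝ n (sq : (Fin d → ℝ) → ℝ) := by
  unfold sq
  fun_prop

theorem Gw_contDiff {n : WithTop ℕ∞} (t : ℝ) : ContDiff ℝ n (Gw t : (Fin d → ℝ) → ℝ) := by
  unfold Gw
  have := sq_contDiff (d := d) (n := n)
  fun_prop

theorem pd_mul {f g : (Fin d → ℝ) → ℝ} {x : Fin d → ℝ} (i : Fin d)
    (hf : DifferentiableAt ℝ f x) (hg : DifferentiableAt ℝ g x) :
    pd i (fun y => f y * g y) x = pd i f x * g x + f x * pd i g x := by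
  simp only [pd]
  rw [fderiv_fun_mul hf hg]
  simp; ring

theorem pd_coord (i j : Fin d) (x : Fin d → ℝ) :
    pd i (fun y => y j) x = if j = i then 1 else 0 := by
  simp only [pd]
  have : HasFDerivAt (fun y : Fin d → ℝ => y j) (ContinuousLinearMap.proj j) x :=
    (ContinuousLinearMap.proj (R := ℝ) (φ := fun _ : Fin d => ℝ) j).hasFDerivAt
  rw [this.fderiv]
  simp [Pi.single_apply]

theorem pd_sq (i : Fin d) (x : Fin d → ℝ) : pd i sq x = 2 * x i := by
  have h : ∀ j, HasFDerivAt (fun y : Fin d → ℝ => y j)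
      (ContinuousLinearMap.proj j : (Fin d → ℝ) →L[ℝ] ℝ) x := fun j =>
    (ContinuousLinearMap.proj (R := ℝ) (φ := fun _ : Fin d => ℝ) j).hasFDerivAt
  have h2 := HasFDerivAt.fun_sum (u := Finset.univ) fun j _ => (h j).pow 2
  have h3 : HasFDerivAt (sq : (Fin d → ℝ) → ℝ) _ x := h2
  rw [pd, h3.fderiv]
  simp [Pi.single_apply]

theorem pd_Gw (i : Fin d) (t : ℝ) (x : Fin d → ℝ) :
    pd i (Gw t) x = -(x i / (2 * t)) * Gw t x := by
  have h1 : HasFDerivAt (sq : (Fin d → ℝ) → ℝ) (fderiv ℝ sq x) x :=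
    ((sq_contDiff (n := 1)).differentiable (by simp) x).hasFDerivAt
  have h1' : HasFDerivAt (fun y : Fin d → ℝ => sq y * (4 * t)⁻¹) ((4 * t)⁻¹ • fderiv ℝ sq x) x :=
    h1.mul_const _
  have h2 := (HasFDerivAt.const_sub h1' (-((d : ℝ) / 2) * Real.log t)).exp
  have h3 : HasFDerivAt (Gw t : (Fin d → ℝ) → ℝ)
      (Gw t x • -((4 * t)⁻¹ • fderiv ℝ sq x)) x := by
    unfold Gw; simp only [div_eq_mul_inv] at h2 ⊢; exact h2
  rw [pd, h3.fderiv]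
  have := pd_sq i x
  rw [pd] at this
  simp only [smul_apply, neg_apply, this, smul_eq_mul, Gw,
    div_eq_mul_inv, mul_inv]
  ring

theorem Gw_hasDerivAt {t : ℝ} (ht : 0 < t) (x : Fin d → ℝ) :
    HasDerivAt (fun s => Gw s x) ((-((d : ℝ) / 2) / t + sq x / (4 * t ^ 2)) * Gw t x) t := by
  unfold Gw
  have h1 := (Real.hasDerivAt_log ht.ne').const_mul (-((d : ℝ) / 2))
  have h2 := ((hasDerivAt_inv ht.ne').const_mul (sq x / 4))
  have h3 := (h1.sub h2).exp
  have e : (fun s : ℝ => Real.exp (-((d : ℝ) / 2) * Real.log s - sq x / (4 * s))) =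
      fun s => Real.exp (-((d : ℝ) / 2) * Real.log s - sq x / 4 * s⁻¹) := by
    funext s; rw [div_mul_eq_div_div, div_eq_mul_inv (sq x / 4) s]
  rw [e]
  refine h3.congr_deriv ?_
  show Real.exp (-((d : ℝ) / 2) * Real.log t - sq x / 4 * t⁻¹) * _ = _
  have e2 : sq x / (4 * t) = sq x / 4 * t⁻¹ := by
    rw [div_mul_eq_div_div, div_eq_mul_inv (sq x / 4) t]
  rw [e2]
  generalize Real.exp (-((d : ℝ) / 2) * Real.log t - sq x / 4 * t⁻¹) = z
  field_simp
  ring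

theorem Gw_continuousOn : ContinuousOn (fun q : ST d => Gw q.2 q.1) {q | 0 < q.2} := by
  intro q hq
  have hq' : (0 : ℝ) < q.2 := hq
  have h1 : Continuous (sq : (Fin d → ℝ) → ℝ) := (sq_contDiff (n := 1)).continuous
  unfold Gw
  apply ContinuousAt.continuousWithinAt
  have h3 : (4 * q.2) ≠ 0 := by positivity
  have h4 : ContinuousAt (fun q : ST d => sq q.1) q := (h1.comp continuous_fst).continuousAt
  have h5 : ContinuousAt (fun q : ST d => Real.log q.2) q :=
    continuous_snd.continuousAt.log hq'.ne'
  have h6 : ContinuousAt (fun q : ST d => 4 * q.2) q := by fun_prop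
  exact ((continuousAt_const.mul h5).sub (h4.div h6 h3)).rexp

theorem int_pd_zero {g : (Fin d → ℝ) → ℝ} (hg : ContDiff ℝ 1 g) (hc : HasCompactSupport g)
    (i : Fin d) : ∫ x, pd i g x = 0 := by
  have hcont : Continuous (fun x => pd i g x) := by
    have := hg.continuous_fderiv (by simp)
    exact this.clm_apply continuous_const
  have hcs : HasCompactSupport (fun x => pd i g x) := hc.fderiv_apply ℝ _
  have := integral_mul_fderiv_eq_neg_fderiv_mul_of_integrable (μ := (volume : Measure (Fin d → ℝ)))
    (f := fun _ => (1 : ℝ)) (g := g) (v := Pi.single i 1)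
    (by simp) (by simpa [pd] using hcont.integrable_of_hasCompactSupport hcs)
    (by simpa using hg.continuous.integrable_of_hasCompactSupport hc)
    (fun x _ => differentiableAt_const _) (fun x _ => hg.differentiable (by simp) x)
  simpa [pd] using this

theorem integ {K : Set (Fin d → ℝ)} (hK : IsCompact K) {g : (Fin d → ℝ) → ℝ} (hg : Continuous g)
    (h0 : ∀ x ∉ K, g x = 0) (t : ℝ) : Integrable (fun x => g x * Gw t x) := by
  refine Continuous.integrable_of_hasCompactSupport
    (hg.mul (Gw_contDiff (n := 1) t).continuous) ?_
  exact HasCompactSupport.intro hK fun x hx => by simp [h0 x hx]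

theorem pd_continuous {g : (Fin d → ℝ) → ℝ} (hg : ContDiff ℝ 1 g) (i : Fin d) :
    Continuous (pd i g) :=
  (hg.continuous_fderiv (by simp)).clm_apply continuous_const

theorem pd_contDiff {g : (Fin d → ℝ) → ℝ} (hg : ContDiff ℝ 2 g) (i : Fin d) :
    ContDiff ℝ 1 (pd i g) :=
  (hg.fderiv_right (m := 1) (by norm_num)).clm_apply contDiff_const

theorem pd_zero_out {K : Set (Fin d → ℝ)} (hK : IsClosed K) {g : (Fin d → ℝ) → ℝ}
    (h0 : ∀ x ∉ K, g x = 0) (i : Fin d) : ∀ x ∉ K, pd i g x = 0 := by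
  intro x hx
  have : g =ᶠ[𝓝 x] fun _ => 0 := by
    filter_upwards [hK.isOpen_compl.mem_nhds hx] with y hy using h0 y hy
  simp [pd, this.fderiv_eq]

theorem symm_identity {K : Set (Fin d → ℝ)} (hK : IsCompact K) {u φ : (Fin d → ℝ) → ℝ}
    (hu : ContDiff ℝ 2 u) (hφ : ContDiff ℝ 1 φ) (h0 : ∀ x ∉ K, u x = 0) (t : ℝ) :
    ∫ x, ((∑ j, pd j (pd j u) x - ∑ j, x j / (2 * t) * pd j u x) * φ x) * Gw t x
      = - ∫ x, (∑ j, pd j u x * pd j φ x) * Gw t x := by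
  have hG := Gw_contDiff (d := d) (n := 1) t
  have hz := pd_zero_out hK.isClosed h0
  have hc : ∀ j, ContDiff ℝ 1 (fun x => pd j u x * φ x * Gw t x) := fun j =>
    ((pd_contDiff hu j).mul hφ).mul hG
  have key : ∀ j, ∫ x, pd j (fun x => pd j u x * φ x * Gw t x) x = 0 := fun j =>
    int_pd_zero (hc j) (HasCompactSupport.intro hK fun x hx => by simp [hz j x hx]) j
  have pt : ∀ j x, pd j (fun x => pd j u x * φ x * Gw t x) x =
      (pd j (pd j u) x - x j / (2 * t) * pd j u x) * φ x * Gw t x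
        + pd j u x * pd j φ x * Gw t x := by
    intro j x
    have d1 := (pd_contDiff hu j).differentiable (by simp) x
    have d2 := hφ.differentiable (by simp) x
    have d3 := hG.differentiable (by simp) x
    rw [pd_mul j (d1.fun_mul d2) d3, pd_mul j d1 d2, pd_Gw]
    ring
  have i1 : ∀ j, Integrable (fun x => pd j (fun x => pd j u x * φ x * Gw t x) x) := fun j =>
    (pd_continuous (hc j) j).integrable_of_hasCompactSupport
      ((HasCompactSupport.intro hK fun x hx => by simp [hz j x hx]).fderiv_apply ℝ _)
  have hφc := hφ.continuous
  have i2 : Integrable (fun x => (∑ j, pd j u x * pd j φ x) * Gw t x) := by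
    refine integ hK ?_ (fun x hx => Finset.sum_eq_zero fun j _ => by simp [hz j x hx]) t
    exact continuous_finsetSum _ fun j _ => (pd_contDiff hu j).continuous.mul (pd_continuous hφ j)
  have i3 : Integrable (fun x =>
      ((∑ j, pd j (pd j u) x - ∑ j, x j / (2 * t) * pd j u x) * φ x) * Gw t x) := by
    refine integ hK ?_ (fun x hx => ?_) t
    · refine Continuous.mul (Continuous.sub ?_ ?_) hφc
      · exact continuous_finsetSum _ fun j _ => pd_continuous (pd_contDiff hu j) j
      · refine continuous_finsetSum _ fun j _ => Continuous.mul (by fun_prop) (pd_contDiff hu j).continuous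
    · have h2 : ∀ j, pd j (pd j u) x = 0 := fun j => pd_zero_out hK.isClosed (hz j) j x hx
      simp [h2, hz _ x hx]
  have tot : ∫ x, ∑ j, pd j (fun x => pd j u x * φ x * Gw t x) x = 0 := by
    rw [integral_finsetSum _ fun j _ => i1 j]
    exact Finset.sum_eq_zero fun j _ => key j
  have e : (fun x => ∑ j, pd j (fun x => pd j u x * φ x * Gw t x) x) = fun x =>
      ((∑ j, pd j (pd j u) x - ∑ j, x j / (2 * t) * pd j u x) * φ x) * Gw t x +
      (∑ j, pd j u x * pd j φ x) * Gw t x := by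
    funext x
    rw [Finset.sum_congr rfl fun j _ => pt j x, Finset.sum_add_distrib, ← Finset.sum_mul,
      ← Finset.sum_mul, ← Finset.sum_mul, Finset.sum_sub_distrib]
  rw [e, integral_add i3 i2] at tot
  linarith

/-- Functions on space-time that vanish for `x` outside `K`. -/
def OutZ (K : Set (Fin d → ℝ)) (f : ST d → ℝ) : Prop := ∀ x ∉ K, ∀ t, f (x, t) = 0

theorem OutZ.Dd {K : Set (Fin d → ℝ)} (hK : IsClosed K) {f : ST d → ℝ} (hf : OutZ K f)
    (o : Option (Fin d)) : OutZ K (Dd o f) := by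
  intro x hx t
  have hn : {q : ST d | q.1 ∉ K} ∈ 𝓝 ((x, t) : ST d) :=
    (hK.isOpen_compl.preimage continuous_fst).mem_nhds hx
  have : f =ᶠ[𝓝 (x, t)] fun _ => 0 := by
    filter_upwards [hn] with q hq using hf q.1 hq q.2
  simp [Nodal.Dd, this.fderiv_eq]

theorem Dd_contDiff {f : ST d → ℝ} (hf : ContDiff ℝ ∞ f) (o : Option (Fin d)) :
    ContDiff ℝ ∞ (Dd o f) := by
  rw [← contDiffOn_univ] at hf ⊢
  exact Dd_smooth isOpen_univ hf o

theorem slice_contDiff {n : WithTop ℕ∞} {f : ST d → ℝ} (hf : ContDiff ℝ n f) (t : ℝ) :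
    ContDiff ℝ n (fun x => f (x, t)) := hf.comp (contDiff_id.prodMk contDiff_const)

theorem pd_slice {f : ST d → ℝ} (hf : ContDiff ℝ ∞ f) (t : ℝ) (i : Fin d) :
    pd i (fun x => f (x, t)) = fun x => Dd (some i) f (x, t) := by
  funext x
  exact pd_eq (fun y s => f (y, s)) x t i (hf.differentiable (by simp) _)

theorem time_deriv {K : Set (Fin d → ℝ)} (hK : IsCompact K) {f : ST d → ℝ}
    (hf : ContDiff ℝ ∞ f) (h0 : OutZ K f) {t : ℝ} (ht : 0 < t) :
    HasDerivAt (fun s => ∫ x, f (x, s) * Gw s x)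
      (∫ x, (Dd none f (x, t) + ∑ j, x j / (2 * t) * Dd (some j) f (x, t)) * Gw t x) t := by
  set F' : ℝ → (Fin d → ℝ) → ℝ := fun s x => Dd none f (x, s) * Gw s x +
    f (x, s) * ((-((d : ℝ) / 2) / s + sq x / (4 * s ^ 2)) * Gw s x) with hF'
  have hDc := (Dd_contDiff hf none).continuous
  have hsqc : Continuous (sq : (Fin d → ℝ) → ℝ) := (sq_contDiff (n := 1)).continuous
  -- bound
  have hcont : ContinuousOn (fun q : ST d => F' q.2 q.1) (K ×ˢ Icc (t / 2) (2 * t)) := by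
    have hG : ContinuousOn (fun q : ST d => Gw q.2 q.1) (K ×ˢ Icc (t / 2) (2 * t)) :=
      Gw_continuousOn.mono fun q hq => by
        have := hq.2.1
        show 0 < q.2
        linarith
    have hne : ∀ q ∈ K ×ˢ Icc (t / 2) (2 * t), q.2 ≠ 0 := fun q hq => by
      have := hq.2.1
      exact ne_of_gt (by linarith)
    simp only [hF']
    refine ContinuousOn.add ?_ ?_
    · exact (hDc.comp (by fun_prop : Continuous fun q : ST d => (q.1, q.2))).continuousOn.mul hG
    · refine ContinuousOn.mul (hf.continuous.comp (by fun_prop : Continuous fun q : ST d => (q.1, q.2))).continuousOn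
        (ContinuousOn.mul (ContinuousOn.add ?_ ?_) hG)
      · exact continuousOn_const.div continuousOn_snd hne
      · refine (hsqc.comp continuous_fst).continuousOn.div (by fun_prop) fun q hq => ?_
        have := hne q hq
        positivity
  obtain ⟨C, hC⟩ := (hK.prod isCompact_Icc).exists_bound_of_continuousOn hcont
  have hs : Ioo (t / 2) (2 * t) ∈ 𝓝 t := Ioo_mem_nhds (by linarith) (by linarith)
  have hmain := hasDerivAt_integral_of_dominated_loc_of_deriv_le (μ := (volume : Measure (Fin d → ℝ)))
    (F := fun s x => f (x, s) * Gw s x) (F' := F') (x₀ := t) (s := Ioo (t / 2) (2 * t))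
    (bound := K.indicator fun _ => C) hs
    (Filter.Eventually.of_forall fun s =>
      (((slice_contDiff hf s).continuous.mul (Gw_contDiff (n := 1) s).continuous)).aestronglyMeasurable)
    (integ hK (slice_contDiff hf t).continuous (fun x hx => h0 x hx t) t)
    (by
      apply Continuous.aestronglyMeasurable
      simp only [hF']
      have h1 := (slice_contDiff (Dd_contDiff hf none) t).continuous
      have h2 := (Gw_contDiff (d := d) (n := 1) t).continuous
      have h3 := (slice_contDiff hf t).continuous
      fun_prop)
    (Filter.Eventually.of_forall fun x s hs => by
      by_cases hx : x ∈ K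
      · rw [indicator_of_mem hx]
        exact hC (x, s) ⟨hx, hs.1.le, hs.2.le⟩
      · rw [indicator_of_notMem hx]
        simp [hF', h0 x hx s, (h0.Dd hK.isClosed none) x hx s])
    ((integrable_indicator_iff hK.measurableSet).2 (integrableOn_const hK.measure_lt_top.ne))
    (Filter.Eventually.of_forall fun x s hs => by
      have hs0 : 0 < s := by have := hs.1; linarith
      have d1 : HasDerivAt (fun s => f (x, s)) (Dd none f (x, s)) s := by
        rw [← deriv_eq (fun y s => f (y, s)) x s (hf.differentiable (by simp) _)]
        have : Differentiable ℝ fun s => f (x, s) :=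
          (hf.differentiable (by simp)).comp (by fun_prop)
        exact (this s).hasDerivAt
      exact d1.mul (Gw_hasDerivAt hs0 x))
  refine hmain.2.congr_deriv ?_
  -- integration by parts
  have hG := Gw_contDiff (d := d) (n := 1) t
  have hfs : ContDiff ℝ 1 (fun x => f (x, t)) := slice_contDiff (hf.of_le (by simp)) t
  have hc : ∀ j, ContDiff ℝ 1 (fun x => f (x, t) * x j * Gw t x) := fun j =>
    (hfs.mul (by fun_prop)).mul hG
  have key : ∀ j, ∫ x, pd j (fun x => f (x, t) * x j * Gw t x) x = 0 := fun j =>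
    int_pd_zero (hc j) (HasCompactSupport.intro hK fun x hx => by simp [h0 x hx t]) j
  have i1 : ∀ j, Integrable (fun x => pd j (fun x => f (x, t) * x j * Gw t x) x) := fun j =>
    (pd_continuous (hc j) j).integrable_of_hasCompactSupport
      ((HasCompactSupport.intro hK fun x hx => by simp [h0 x hx t]).fderiv_apply ℝ _)
  have tot : ∫ x, ∑ j, pd j (fun x => f (x, t) * x j * Gw t x) x = 0 := by
    rw [integral_finsetSum _ fun j _ => i1 j]
    exact Finset.sum_eq_zero fun j _ => key j
  have pt : ∀ j x, pd j (fun x => f (x, t) * x j * Gw t x) x =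
      (x j * Dd (some j) f (x, t)) * Gw t x + (f (x, t) * Gw t x)
        - (f (x, t) * Gw t x / (2 * t)) * x j ^ 2 := by
    intro j x
    have d1 := hfs.differentiable (by simp) x
    have d2 : DifferentiableAt ℝ (fun x : Fin d → ℝ => x j) x := by fun_prop
    have d3 := hG.differentiable (by simp) x
    rw [pd_mul j (d1.fun_mul d2) d3, pd_mul j d1 d2, pd_Gw, pd_slice hf, pd_coord]
    simp
    ring
  have i2 : Integrable (F' t) := hmain.1
  have e : (fun x => (Dd none f (x, t) + ∑ j, x j / (2 * t) * Dd (some j) f (x, t)) * Gw t x) =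
      fun x => F' t x + (1 / (2 * t)) * ∑ j, pd j (fun x => f (x, t) * x j * Gw t x) x := by
    funext x
    rw [Finset.sum_congr rfl fun j _ => pt j x, Finset.sum_sub_distrib, Finset.sum_add_distrib,
      ← Finset.sum_mul, ← Finset.mul_sum (Finset.univ) (fun j => x j ^ 2)]
    have : ∑ j, x j / (2 * t) * Dd (some j) f (x, t)
        = (1 / (2 * t)) * ∑ j, x j * Dd (some j) f (x, t) := by
      rw [Finset.mul_sum]; refine Finset.sum_congr rfl fun j _ => by ring
    rw [this]
    simp only [hF', Finset.sum_const, Finset.card_univ, Fintype.card_fin, nsmul_eq_mul]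
    have hsq : ∑ j, x j ^ 2 = sq x := rfl
    rw [hsq]
    field_simp
    ring
  rw [e, integral_add i2 ((integrable_finsetSum _ fun j _ => i1 j).const_mul _),
    integral_const_mul, tot]
  simp

end gauss
end Nodal


open scoped ContDiff Topology
open Filter

namespace Nodal
section freq
variable {d : ℕ}

noncomputable def Xf (w : ST d → ℝ) (t : ℝ) (x : Fin d → ℝ) : ℝ :=
  Dd none w (x, t) + ∑ j, x j / (2 * t) * Dd (some j) w (x, t)

noncomputable def Lf (w : ST d → ℝ) (t : ℝ) (x : Fin d → ℝ) : ℝ :=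
  ∑ j, Dd (some j) (Dd (some j) w) (x, t) - ∑ j, x j / (2 * t) * Dd (some j) w (x, t)

noncomputable def Hf (w : ST d → ℝ) (t : ℝ) : ℝ := ∫ x, w (x, t) ^ 2 * Gw t x

noncomputable def Df (w : ST d → ℝ) (t : ℝ) : ℝ :=
  ∫ x, (∑ j, Dd (some j) w (x, t) ^ 2) * Gw t x

/-- The backward heat operator. -/
noncomputable def Ff (w : ST d → ℝ) (t : ℝ) (x : Fin d → ℝ) : ℝ :=
  Dd none w (x, t) + ∑ j, Dd (some j) (Dd (some j) w) (x, t)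

variable {K : Set (Fin d → ℝ)} {w : ST d → ℝ}

theorem Xf_contDiff (hw : ContDiff ℝ ∞ w) (t : ℝ) : ContDiff ℝ 1 (Xf w t) := by
  unfold Xf
  have h1 : ∀ o, ContDiff ℝ 1 (fun x => Dd o w (x, t)) := fun o =>
    slice_contDiff ((Dd_contDiff hw o).of_le (by simp)) t
  refine (h1 none).add (ContDiff.sum fun j _ => ContDiff.mul ?_ (h1 _))
  fun_prop

theorem Lf_cont (hw : ContDiff ℝ ∞ w) (t : ℝ) : Continuous (Lf w t) := by
  unfold Lf
  have h1 : ∀ o, Continuous (fun x => Dd o w (x, t)) := fun o =>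
    (slice_contDiff (Dd_contDiff hw o) t).continuous
  have h2 : ∀ o o', Continuous (fun x => Dd o (Dd o' w) (x, t)) := fun o o' =>
    (slice_contDiff (Dd_contDiff (Dd_contDiff hw o') o) t).continuous
  refine (continuous_finsetSum _ fun j _ => h2 _ _).sub
    (continuous_finsetSum _ fun j _ => Continuous.mul (by fun_prop) (h1 _))

theorem Ff_cont (hw : ContDiff ℝ ∞ w) : Continuous (fun q : ST d => Ff w q.2 q.1) := by
  unfold Ff
  exact (Dd_contDiff hw none).continuous.add
    (continuous_finsetSum _ fun j _ => (Dd_contDiff (Dd_contDiff hw _) _).continuous)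

theorem Ff_eq (t : ℝ) (x : Fin d → ℝ) : Ff w t x = Xf w t x + Lf w t x := by
  unfold Ff Xf Lf; ring

theorem Xf_out (hK : IsClosed K) (h0 : OutZ K w) (t : ℝ) : ∀ x ∉ K, Xf w t x = 0 := by
  intro x hx
  simp [Xf, (h0.Dd hK _) x hx t]

theorem Lf_out (hK : IsClosed K) (h0 : OutZ K w) (t : ℝ) : ∀ x ∉ K, Lf w t x = 0 := by
  intro x hx
  simp [Lf, (h0.Dd hK _) x hx t, ((h0.Dd hK _).Dd hK _) x hx t]

theorem Dd_sq (hw : ContDiff ℝ ∞ w) (o : Option (Fin d)) (q : ST d) :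
    Dd o (fun p => w p ^ 2) q = 2 * w q * Dd o w q := by
  have h := (hw.differentiable (by simp) q).hasFDerivAt.pow 2
  have h' : HasFDerivAt (fun p => w p ^ 2) _ q := h
  simp only [Dd]
  rw [h'.fderiv]
  simp
  

theorem Hf_deriv (hK : IsCompact K) (hw : ContDiff ℝ ∞ w) (h0 : OutZ K w) {t : ℝ} (ht : 0 < t) :
    HasDerivAt (Hf w) (2 * ∫ x, (w (x, t) * Xf w t x) * Gw t x) t := by
  have := time_deriv hK (f := fun q => w q ^ 2) (hw.pow 2)
    (fun x hx s => by simp [h0 x hx s]) ht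
  refine this.congr_deriv ?_
  rw [← integral_const_mul]
  refine integral_congr_ae (Filter.Eventually.of_forall fun x => ?_)
  simp only [Dd_sq hw, Xf]
  have e : ∑ j, x j / (2 * t) * (2 * w (x, t) * Dd (some j) w (x, t)) =
      2 * w (x, t) * ∑ j, x j / (2 * t) * Dd (some j) w (x, t) := by
    rw [Finset.mul_sum]
    exact Finset.sum_congr rfl fun j _ => by ring
  rw [e]
  ring

theorem Dd_sum_sq (hw : ContDiff ℝ ∞ w) (o : Option (Fin d)) (q : ST d) :
    Dd o (fun p => ∑ i, Dd (some i) w p ^ 2) q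
      = ∑ i, 2 * Dd (some i) w q * Dd o (Dd (some i) w) q := by
  have hd : ∀ i : Fin d, DifferentiableAt ℝ (fun p => Dd (some i) w p ^ 2) q := fun i =>
    (((Dd_contDiff hw (some i)).pow 2).differentiable (by simp) q)
  have : Dd o (fun p => ∑ i, Dd (some i) w p ^ 2) q =
      ∑ i, Dd o (fun p => Dd (some i) w p ^ 2) q := by
    simp only [Dd] at hd ⊢
    rw [fderiv_fun_sum fun i _ => hd i]
    simp
  rw [this]
  exact Finset.sum_congr rfl fun i _ => Dd_sq (Dd_contDiff hw _) o q

theorem Dd_comm' (hw : ContDiff ℝ ∞ w) (o o' : Option (Fin d)) (q : ST d) :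
    Dd o (Dd o' w) q = Dd o' (Dd o w) q :=
  Dd_comm isOpen_univ (contDiffOn_univ.2 hw) o o' (mem_univ q)

theorem pd_Xf (hw : ContDiff ℝ ∞ w) (t : ℝ) (i : Fin d) (x : Fin d → ℝ) :
    pd i (Xf w t) x = Xf (Dd (some i) w) t x + Dd (some i) w (x, t) / (2 * t) := by
  have hd : ∀ o, DifferentiableAt ℝ (fun x => Dd o w (x, t)) x := fun o =>
    (slice_contDiff (Dd_contDiff hw o) t).differentiable (by simp) x
  have hc : ∀ j : Fin d, DifferentiableAt ℝ (fun x : Fin d → ℝ => x j / (2 * t)) x := fun j => by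
    fun_prop
  have hpc : ∀ j : Fin d, pd i (fun x : Fin d → ℝ => x j / (2 * t)) x =
      (if j = i then 1 else 0) / (2 * t) := by
    intro j
    rw [← pd_coord i j x]
    simp only [pd, div_eq_mul_inv]
    rw [fderiv_mul_const (by fun_prop)]
    simp [mul_comm]
  have e1 : pd i (Xf w t) x = pd i (fun x => Dd none w (x, t)) x +
      ∑ j, pd i (fun x => x j / (2 * t) * Dd (some j) w (x, t)) x := by
    simp only [pd]
    have : Xf w t = fun x => Dd none w (x, t) + ∑ j, x j / (2 * t) * Dd (some j) w (x, t) := rfl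
    rw [this, fderiv_fun_add (hd none)
      (DifferentiableAt.fun_sum fun j _ => (hc j).fun_mul (hd (some j))),
      fderiv_fun_sum fun j _ => (hc j).fun_mul (hd (some j))]
    simp
  have e2 : ∀ j, pd i (fun x => x j / (2 * t) * Dd (some j) w (x, t)) x =
      (if j = i then 1 else 0) / (2 * t) * Dd (some j) w (x, t)
       + x j / (2 * t) * Dd (some j) (Dd (some i) w) (x, t) := by
    intro j
    rw [pd_mul i (hc j) (hd (some j)), hpc, pd_slice (Dd_contDiff hw _), Dd_comm' hw]
  rw [e1, Finset.sum_congr rfl fun j _ => e2 j, Finset.sum_add_distrib,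
    pd_slice (Dd_contDiff hw _)]
  simp only [Xf, ite_div, ite_mul, zero_div, zero_mul, Finset.sum_ite_eq', Finset.mem_univ, if_true]
  rw [Dd_comm' hw]
  ring

theorem symm_w (hK : IsCompact K) (hw : ContDiff ℝ ∞ w) (h0 : OutZ K w) (t : ℝ)
    {φ : (Fin d → ℝ) → ℝ} (hφ : ContDiff ℝ 1 φ) :
    ∫ x, (Lf w t x * φ x) * Gw t x = - ∫ x, (∑ j, Dd (some j) w (x, t) * pd j φ x) * Gw t x := by
  have := symm_identity hK (u := fun x => w (x, t)) (slice_contDiff (hw.of_le (by exact WithTop.coe_le_coe.2 le_top)) t) hφ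
    (fun x hx => h0 x hx t) t
  simp only [pd_slice hw, pd_slice (Dd_contDiff hw _)] at this
  exact this

theorem wL_eq (hK : IsCompact K) (hw : ContDiff ℝ ∞ w) (h0 : OutZ K w) (t : ℝ) :
    ∫ x, (Lf w t x * w (x, t)) * Gw t x = - Df w t := by
  rw [symm_w hK hw h0 t (φ := fun x => w (x, t)) (slice_contDiff (hw.of_le (by simp)) t)]
  simp only [pd_slice hw, Df]
  congr 2
  funext x
  congr 1
  exact Finset.sum_congr rfl fun j _ => by ring

theorem Df_deriv (hK : IsCompact K) (hw : ContDiff ℝ ∞ w) (h0 : OutZ K w) {t : ℝ} (ht : 0 < t) :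
    HasDerivAt (Df w) (-2 * (∫ x, (Lf w t x * Xf w t x) * Gw t x) - Df w t / t) t := by
  have h1 := h0.Dd hK.isClosed
  have := time_deriv hK (f := fun q => ∑ i, Dd (some i) w q ^ 2)
    (ContDiff.sum fun i _ => (Dd_contDiff hw _).pow 2)
    (fun x hx s => by simp [h1 _ x hx s]) ht
  refine this.congr_deriv ?_
  rw [symm_w hK hw h0 t (Xf_contDiff hw t)]
  have hc1 : ∀ o, Continuous (fun x => Dd o w (x, t)) := fun o =>
    (slice_contDiff (Dd_contDiff hw o) t).continuous
  have i1 : Integrable fun x => (∑ j, Dd (some j) w (x, t) * pd j (Xf w t) x) * Gw t x := by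
    refine integ hK (continuous_finsetSum _ fun j _ => (hc1 _).mul (pd_continuous (Xf_contDiff hw t) j))
      (fun x hx => by simp [h1 _ x hx t]) t
  have i2 : Integrable fun x => (∑ j, Dd (some j) w (x, t) ^ 2) * Gw t x := by
    refine integ hK (continuous_finsetSum _ fun j _ => (hc1 _).pow 2)
      (fun x hx => by simp [h1 _ x hx t]) t
  rw [Df, mul_neg, neg_mul, neg_neg, ← integral_const_mul, ← integral_div,
    ← integral_sub (i1.const_mul 2) (i2.div_const t)]
  refine integral_congr_ae (Filter.Eventually.of_forall fun x => ?_)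
  simp only [Dd_sum_sq hw, pd_Xf hw, Xf]
  have e : ∑ x_1 : Fin d, x x_1 / (2 * t) *
        ∑ i, 2 * Dd (some i) w (x, t) * Dd (some x_1) (Dd (some i) w) (x, t) =
      ∑ i, 2 * Dd (some i) w (x, t) *
        ∑ j, x j / (2 * t) * Dd (some j) (Dd (some i) w) (x, t) := by
    simp_rw [Finset.mul_sum]
    rw [Finset.sum_comm]
    refine Finset.sum_congr rfl fun i _ => Finset.sum_congr rfl fun j _ => by ring
  rw [e, ← Finset.sum_add_distrib, ← mul_assoc, Finset.mul_sum, mul_div_right_comm, Finset.sum_div,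
    ← sub_mul, ← Finset.sum_sub_distrib]
  congr 1
  refine Finset.sum_congr rfl fun i _ => ?_
  field_simp
  ring

/-- The quantity that is almost monotone. -/
noncomputable def Qf (w : ST d → ℝ) (c α : ℝ) (t : ℝ) : ℝ :=
  Real.exp (-2 * α * (Real.log t - c * t)) *
    (α * Hf w t - t / (1 - c * t) * Df w t + t / 2 * Hf w t)

set_option maxHeartbeats 1000000 in
theorem Qf_deriv (hK : IsCompact K) (hw : ContDiff ℝ ∞ w) (h0 : OutZ K w) {t c α : ℝ} (ht : 0 < t)
    (ht1 : t ≤ 1) (hc : 0 ≤ c) (hct : c * t ≤ 1 / 2) (hα : 0 ≤ α) :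
    ∃ k : ℝ, HasDerivAt (Qf w c α) (Real.exp (-2 * α * (Real.log t - c * t)) * k) t ∧
      k ≤ 3 / 2 * t * (∫ x, Ff w t x ^ 2 * Gw t x) - (c - 1) * t * Df w t
        + (1 - α / 2) * Hf w t := by
  set A2 := ∫ x, (w (x, t) * Xf w t x) * Gw t x with hA2
  set A3 := ∫ x, (Lf w t x * Xf w t x) * Gw t x with hA3
  set A5 := ∫ x, Ff w t x ^ 2 * Gw t x with hA5
  set s := 1 - c * t with hs
  have hs2 : 1 / 2 ≤ s := by rw [hs]; linarith
  have hs1 : s ≤ 1 := by rw [hs]; nlinarith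
  have hs0 : 0 < s := by linarith
  have dH := Hf_deriv hK hw h0 ht
  have dD := Df_deriv hK hw h0 ht
  rw [← hA2] at dH
  rw [← hA3] at dD
  have A4 := wL_eq hK hw h0 t
  -- integrability
  have cw : Continuous (fun x => w (x, t)) := (slice_contDiff hw t).continuous
  have cX : Continuous (Xf w t) := (Xf_contDiff hw t).continuous
  have cL := Lf_cont hw t
  have oX := Xf_out hK.isClosed h0 t
  have oL := Lf_out hK.isClosed h0 t
  have cF : Continuous (Ff w t) := by
    have : Ff w t = fun x => Xf w t x + Lf w t x := funext fun x => Ff_eq t x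
    rw [this]; exact cX.add cL
  have oF : ∀ x ∉ K, Ff w t x = 0 := fun x hx => by rw [Ff_eq, oX x hx, oL x hx, add_zero]
  have iH : Integrable fun x => w (x, t) ^ 2 * Gw t x :=
    integ hK (cw.pow 2) (fun x hx => by simp [h0 x hx t]) t
  have i2 : Integrable fun x => (w (x, t) * Xf w t x) * Gw t x :=
    integ hK (cw.mul cX) (fun x hx => by simp [h0 x hx t]) t
  have i3 : Integrable fun x => (Lf w t x * Xf w t x) * Gw t x :=
    integ hK (cL.mul cX) (fun x hx => by simp [oL x hx]) t
  have i4 : Integrable fun x => (Lf w t x * w (x, t)) * Gw t x :=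
    integ hK (cL.mul cw) (fun x hx => by simp [oL x hx]) t
  have i5 : Integrable fun x => Ff w t x ^ 2 * Gw t x :=
    integ hK (cF.pow 2) (fun x hx => by simp [oF x hx]) t
  set β := α * s / t with hβ
  have K1 : 4 * A3 + 4 * β * A2 + 4 * β * Df w t - 4 * β ^ 2 * Hf w t ≤ A5 := by
    have e : ∫ x, (4 * ((Lf w t x * Xf w t x) * Gw t x)
        + (4 * β) * ((w (x, t) * Xf w t x) * Gw t x)
        + ((-(4 * β)) * ((Lf w t x * w (x, t)) * Gw t x)
        + (-(4 * β ^ 2)) * (w (x, t) ^ 2 * Gw t x))) =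
        4 * A3 + 4 * β * A2 + 4 * β * Df w t - 4 * β ^ 2 * Hf w t := by
      have j1 : Integrable fun x => (4 * ((Lf w t x * Xf w t x) * Gw t x)
        + (4 * β) * ((w (x, t) * Xf w t x) * Gw t x)) := (i3.const_mul _).add (i2.const_mul _)
      have j2 : Integrable fun x => ((-(4 * β)) * ((Lf w t x * w (x, t)) * Gw t x)
        + (-(4 * β ^ 2)) * (w (x, t) ^ 2 * Gw t x)) := (i4.const_mul _).add (iH.const_mul _)
      rw [integral_add j1 j2, integral_add (i3.const_mul _) (i2.const_mul _),
        integral_add (i4.const_mul _) (iH.const_mul _)]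
      simp only [integral_const_mul]
      rw [A4]
      simp only [Hf, hA2, hA3]
      ring
    rw [← e]
    refine integral_mono (((i3.const_mul _).add (i2.const_mul _)).add
      ((i4.const_mul _).add (iH.const_mul _))) i5 fun x => ?_
    simp only
    rw [Ff_eq]
    have hG := (Gw_pos t x).le
    have := mul_nonneg (sq_nonneg (Lf w t x + 2 * β * w (x, t) - Xf w t x)) hG
    nlinarith
  have K2 : A2 - Df w t ≤ 1 / 2 * Hf w t + 1 / 2 * A5 := by
    have e : ∫ x, ((w (x, t) * Xf w t x) * Gw t x + (Lf w t x * w (x, t)) * Gw t x) =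
        A2 - Df w t := by
      rw [integral_add i2 i4, A4]; ring
    have e' : ∫ x, (1 / 2 * (w (x, t) ^ 2 * Gw t x) + 1 / 2 * (Ff w t x ^ 2 * Gw t x)) =
        1 / 2 * Hf w t + 1 / 2 * A5 := by
      rw [integral_add (iH.const_mul _) (i5.const_mul _), integral_const_mul, integral_const_mul]
      rfl
    rw [← e, ← e']
    refine integral_mono (i2.add i4) ((iH.const_mul _).add (i5.const_mul _)) fun x => ?_
    simp only
    rw [Ff_eq]
    have hG := (Gw_pos t x).le
    have := mul_nonneg (sq_nonneg (w (x, t) - (Xf w t x + Lf w t x))) hG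
    nlinarith
  have hH0 : 0 ≤ Hf w t := integral_nonneg fun x => mul_nonneg (sq_nonneg _) (Gw_pos t x).le
  have hD0 : 0 ≤ Df w t := integral_nonneg fun x =>
    mul_nonneg (Finset.sum_nonneg fun _ _ => sq_nonneg _) (Gw_pos t x).le
  have hA50 : 0 ≤ A5 := integral_nonneg fun x => mul_nonneg (sq_nonneg _) (Gw_pos t x).le
  -- derivative of Q
  have dE : HasDerivAt (fun t => Real.exp (-2 * α * (Real.log t - c * t)))
      (Real.exp (-2 * α * (Real.log t - c * t)) * (-2 * α * (t⁻¹ - c))) t := by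
    have h1 := (Real.hasDerivAt_log ht.ne').sub ((hasDerivAt_id t).const_mul c)
    have h2 := (h1.const_mul (-2 * α)).exp
    simpa using h2
  have dθ : HasDerivAt (fun t => t / (1 - c * t)) (1 / s ^ 2) t := by
    have h1 := (hasDerivAt_id t).div (((hasDerivAt_id t).const_mul c).const_sub 1) (by simpa using hs0.ne')
    refine h1.congr_deriv ?_
    simp only [id, hs]
    congr 1
    ring
  have dQ := dE.mul (((dH.const_mul α).sub (dθ.mul dD)).add (((hasDerivAt_id t).div_const 2).mul dH))
  refine ⟨(-2 * α * (t⁻¹ - c)) * (α * Hf w t - t / s * Df w t + t / 2 * Hf w t) +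
    (α * (2 * A2) - (1 / s ^ 2 * Df w t + t / s * (-2 * A3 - Df w t / t)) +
      (1 / 2 * Hf w t + t / 2 * (2 * A2))), ?_, ?_⟩
  · refine (dQ.congr_deriv ?_)
    simp only [Pi.add_apply, Pi.sub_apply, Pi.mul_apply, id, ← hs]
    ring
  · have htc : t⁻¹ - c = s / t := by rw [hs]; field_simp
    rw [htc]
    have K1' := mul_le_mul_of_nonneg_left K1 (show 0 ≤ t / (2 * s) by positivity)
    have hA : t / (2 * s) * (4 * A3 + 4 * β * A2 + 4 * β * Df w t - 4 * β ^ 2 * Hf w t) =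
        2 * (t / s) * A3 + 2 * α * A2 + 2 * α * Df w t - 2 * α ^ 2 * (s / t) * Hf w t := by
      rw [hβ]; field_simp; ring
    rw [hA] at K1'
    have hB : -2 * α * (s / t) * (α * Hf w t - t / s * Df w t + t / 2 * Hf w t) +
        (α * (2 * A2) - (1 / s ^ 2 * Df w t + t / s * (-2 * A3 - Df w t / t)) +
        (1 / 2 * Hf w t + t / 2 * (2 * A2))) =
        (2 * (t / s) * A3 + 2 * α * A2 + 2 * α * Df w t - 2 * α ^ 2 * (s / t) * Hf w t)
        - α * s * Hf w t + (1 / s - 1 / s ^ 2) * Df w t + 1 / 2 * Hf w t + t * A2 := by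
      field_simp; ring
    rw [hB]
    have f1 : t / (2 * s) * A5 ≤ t * A5 := by
      refine mul_le_mul_of_nonneg_right ?_ hA50
      rw [div_le_iff₀ (by positivity)]
      nlinarith
    have f2 : (1 / s - 1 / s ^ 2) * Df w t ≤ -(c * t) * Df w t := by
      refine mul_le_mul_of_nonneg_right ?_ hD0
      have : 1 / s - 1 / s ^ 2 = -(c * t) / s ^ 2 := by
        have : c * t = 1 - s := by rw [hs]; ring
        rw [this]; field_simp; ring
      rw [this, div_le_iff₀ (by positivity)]
      have h1 : s ^ 2 ≤ 1 := by nlinarith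
      have h2 : 0 ≤ c * t := by positivity
      nlinarith
    have f3 : -(α * s * Hf w t) ≤ -(α / 2 * Hf w t) := by
      have : α / 2 ≤ α * s := by nlinarith
      exact neg_le_neg (mul_le_mul_of_nonneg_right this hH0)
    have f4 : t * A2 ≤ t * (1 / 2 * Hf w t + 1 / 2 * A5 + Df w t) :=
      mul_le_mul_of_nonneg_left (by linarith) ht.le
    have f5 : t * Hf w t ≤ 1 * Hf w t := mul_le_mul_of_nonneg_right ht1 hH0
    have f4' : t * (1 / 2 * Hf w t + 1 / 2 * A5 + Df w t) =
      1 / 2 * (t * Hf w t) + 1 / 2 * (t * A5) + t * Df w t := by ring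
    have g1 : 3 / 2 * t * A5 - (c - 1) * t * Df w t + (1 - α / 2) * Hf w t =
      3 / 2 * (t * A5) + -(c * t) * Df w t + t * Df w t + Hf w t - α / 2 * Hf w t := by ring
    rw [g1]
    linarith

end freq
end Nodal


open scoped ContDiff Topology
open Filter

namespace Nodal
section core
variable {d : ℕ} {K : Set (Fin d → ℝ)} {w : ST d → ℝ}

/-- Scalar Gaussian factor. -/
noncomputable def gq (d : ℕ) (q t : ℝ) : ℝ := Real.exp (-((d : ℝ) / 2) * Real.log t - q / (4 * t))

theorem gq_pos (q t : ℝ) : 0 < gq d q t := Real.exp_pos _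

theorem Gw_le_gq {q t : ℝ} (ht : 0 < t) {x : Fin d → ℝ} (hx : q ≤ sq x) : Gw t x ≤ gq d q t := by
  unfold Gw gq
  gcongr

theorem gq_le_Gw {q t : ℝ} (ht : 0 < t) {x : Fin d → ℝ} (hx : sq x ≤ q) : gq d q t ≤ Gw t x := by
  unfold Gw gq
  gcongr

theorem F_bound (hK : IsCompact K) (hw : ContDiff ℝ ∞ w) (h0 : OutZ K w) {M R T : ℝ} (hM : 0 ≤ M)
    (hF : ∀ x t, 0 < t → t < T → sq x < R →
      Ff w t x ^ 2 ≤ M * (w (x, t) ^ 2 + ∑ j, Dd (some j) w (x, t) ^ 2)) :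
    ∃ C, 0 ≤ C ∧ ∀ t, 0 < t → t < T → t ≤ 1 →
      ∫ x, Ff w t x ^ 2 * Gw t x ≤ M * (Hf w t + Df w t) + C * gq d R t := by
  have h1 := h0.Dd hK.isClosed
  obtain ⟨C0, hC0⟩ : ∃ C0, ∀ q ∈ K ×ˢ Icc (0:ℝ) 1, |Ff w q.2 q.1 ^ 2| ≤ C0 :=
    (hK.prod isCompact_Icc).exists_bound_of_continuousOn ((Ff_cont hw).pow 2).continuousOn
  have oF : ∀ t, ∀ x ∉ K, Ff w t x = 0 := fun t x hx => by
    simp [Ff, h1 _ x hx t, ((h1 _).Dd hK.isClosed _) x hx t]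
  refine ⟨|C0| * volume.real K, by positivity, fun t ht htT ht1 => ?_⟩
  have cw : Continuous (fun x => w (x, t)) := (slice_contDiff hw t).continuous
  have cD : ∀ o, Continuous (fun x => Dd o w (x, t)) := fun o =>
    (slice_contDiff (Dd_contDiff hw o) t).continuous
  have cF : Continuous (fun x => Ff w t x) :=
    (Ff_cont hw).comp (continuous_id.prodMk continuous_const)
  have iH : Integrable fun x => w (x, t) ^ 2 * Gw t x :=
    integ hK (cw.pow 2) (fun x hx => by simp [h0 x hx t]) t
  have iD : Integrable fun x => (∑ j, Dd (some j) w (x, t) ^ 2) * Gw t x := by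
    refine integ hK (continuous_finsetSum _ fun j _ => (cD _).pow 2)
      (fun x hx => by simp [h1 _ x hx t]) t
  have i5 : Integrable fun x => Ff w t x ^ 2 * Gw t x :=
    integ hK (cF.pow 2) (fun x hx => by simp [oF t x hx]) t
  have iHD : Integrable fun x => M * (w (x, t) ^ 2 * Gw t x +
      (∑ j, Dd (some j) w (x, t) ^ 2) * Gw t x) := (iH.add iD).const_mul M
  have iK : Integrable (K.indicator fun _ => |C0| * gq d R t) := by
    rw [integrable_indicator_iff hK.measurableSet]
    exact integrableOn_const hK.measure_lt_top.ne
  have e : ∫ x, (M * (w (x, t) ^ 2 * Gw t x +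
      (∑ j, Dd (some j) w (x, t) ^ 2) * Gw t x) + K.indicator (fun _ => |C0| * gq d R t) x) =
      M * (Hf w t + Df w t) + |C0| * volume.real K * gq d R t := by
    rw [integral_add iHD iK, integral_const_mul, integral_add iH iD,
      integral_indicator hK.measurableSet, setIntegral_const, Hf, Df, smul_eq_mul]
    ring
  rw [← e]
  refine integral_mono i5 (iHD.add iK) fun x => ?_
  simp only
  have hG := (Gw_pos t x).le
  have hS : 0 ≤ w (x, t) ^ 2 + ∑ j, Dd (some j) w (x, t) ^ 2 :=
    add_nonneg (sq_nonneg _) (Finset.sum_nonneg fun _ _ => sq_nonneg _)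
  rw [← add_mul, ← mul_assoc]
  by_cases hx : x ∈ K
  · rw [indicator_of_mem hx]
    by_cases hR : sq x < R
    · have := mul_le_mul_of_nonneg_right (hF x t ht htT hR) hG
      have h2 : 0 ≤ |C0| * gq d R t := mul_nonneg (abs_nonneg _) (gq_pos _ _).le
      linarith
    · have h2 : Ff w t x ^ 2 ≤ |C0| :=
        (le_abs_self _).trans ((hC0 (x, t) ⟨hx, ht.le, ht1⟩).trans (le_abs_self _))
      have h3 := mul_le_mul h2 (Gw_le_gq ht (not_lt.1 hR)) hG (abs_nonneg _)
      have := mul_nonneg (mul_nonneg hM hS) hG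
      linarith
  · rw [indicator_of_notMem hx, oF t x hx]
    have := mul_nonneg (mul_nonneg hM hS) hG
    simpa using this

theorem H_lower (hK : IsCompact K) (hw : ContDiff ℝ ∞ w) (h0 : OutZ K w) {R : ℝ}
    {x₁ : Fin d → ℝ} (hx : sq x₁ < R) (hne : w (x₁, 0) ≠ 0) :
    ∃ q c δ : ℝ, 0 ≤ q ∧ q < R ∧ 0 < c ∧ 0 < δ ∧ ∀ t, 0 < t → t < δ → c * gq d q t ≤ Hf w t := by
  obtain ⟨q, hq1, hq2⟩ := exists_between hx
  have hpos : 0 < w (x₁, 0) ^ 2 := by positivity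
  obtain ⟨ε, he0, he1⟩ := exists_between hpos
  have hcw : Continuous (fun p : ST d => w p ^ 2) := hw.continuous.pow 2
  have hcs : Continuous (fun p : ST d => sq p.1) :=
    (sq_contDiff (n := 1)).continuous.comp continuous_fst
  have hn : {p : ST d | ε < w p ^ 2 ∧ sq p.1 < q} ∈ 𝓝 ((x₁, 0) : ST d) :=
    ((isOpen_lt continuous_const hcw).inter (isOpen_lt hcs continuous_const)).mem_nhds ⟨he1, hq1⟩
  obtain ⟨r, hr, hball⟩ := Metric.mem_nhds_iff.1 hn
  have hB : 0 < volume.real (Metric.ball x₁ r) := by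
    rw [Measure.real, ENNReal.toReal_pos_iff]
    exact ⟨Metric.measure_ball_pos _ _ hr, measure_ball_lt_top⟩
  refine ⟨q, ε * volume.real (Metric.ball x₁ r), r, (sq_nonneg' _).trans hq1.le, hq2,
    mul_pos he0 hB, hr, fun t ht htr => ?_⟩
  have cw : Continuous (fun x => w (x, t)) := (slice_contDiff hw t).continuous
  have iH : Integrable fun x => w (x, t) ^ 2 * Gw t x :=
    integ hK (cw.pow 2) (fun x hx => by simp [h0 x hx t]) t
  have iB : Integrable ((Metric.ball x₁ r).indicator fun _ => ε * gq d q t) := by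
    rw [integrable_indicator_iff measurableSet_ball]
    exact integrableOn_const measure_ball_lt_top.ne
  have e : ∫ x, (Metric.ball x₁ r).indicator (fun _ => ε * gq d q t) x =
      ε * volume.real (Metric.ball x₁ r) * gq d q t := by
    rw [integral_indicator measurableSet_ball, setIntegral_const, smul_eq_mul]; ring
  rw [← e]
  refine integral_mono iB iH fun x => ?_
  by_cases hxB : x ∈ Metric.ball x₁ r
  · simp only [indicator_of_mem hxB]
    have hm : ((x, t) : ST d) ∈ Metric.ball ((x₁, 0) : ST d) r := by
      rw [← ball_prod_same]
      exact ⟨hxB, by simpa [abs_of_pos ht] using htr⟩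
    have := hball hm
    exact mul_le_mul this.1.le (gq_le_Gw ht this.2.le) (gq_pos _ _).le (sq_nonneg _)
  · simp only [indicator_of_notMem hxB]
    exact mul_nonneg (sq_nonneg _) (Gw_pos _ _).le

theorem H_upper (hK : IsCompact K) (hw : ContDiff ℝ ∞ w) (h0 : OutZ K w) {T : ℝ}
    (hp : ∀ k : ℕ, ∃ C : ℝ, ∀ x t, 0 < t → t < T → w (x, t) ^ 2 ≤ C * (sq x + t) ^ k) (k : ℕ) :
    ∃ C : ℝ, 0 ≤ C ∧ ∀ t, 0 < t → t < T → t ≤ 1 → Hf w t ≤ C * t ^ k := by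
  obtain ⟨C, hC⟩ := hp (k + d)
  set A : ℝ := |C| * (4 ^ (k + d) * (k + d).factorial * Real.exp (1 / 4)) with hA
  have hA0 : 0 ≤ A := by positivity
  refine ⟨A * volume.real K, by positivity, fun t ht htT ht1 => ?_⟩
  have cw : Continuous (fun x => w (x, t)) := (slice_contDiff hw t).continuous
  have iH : Integrable fun x => w (x, t) ^ 2 * Gw t x :=
    integ hK (cw.pow 2) (fun x hx => by simp [h0 x hx t]) t
  have iK : Integrable (K.indicator fun _ => A * t ^ k) := by
    rw [integrable_indicator_iff hK.measurableSet]
    exact integrableOn_const hK.measure_lt_top.ne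
  have e : ∫ x, K.indicator (fun _ => A * t ^ k) x = A * volume.real K * t ^ k := by
    rw [integral_indicator hK.measurableSet, setIntegral_const, smul_eq_mul]; ring
  rw [← e]
  refine integral_mono iH iK fun x => ?_
  by_cases hx : x ∈ K
  · simp only [indicator_of_mem hx]
    have hs : 0 ≤ sq x := sq_nonneg' x
    set s := sq x / t with hsdef
    have hs0 : 0 ≤ s := by positivity
    have e1 : sq x + t = t * (s + 1) := by rw [hsdef]; field_simp
    have b1 : w (x, t) ^ 2 ≤ |C| * (t * (s + 1)) ^ (k + d) := by
      rw [← e1]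
      exact (hC x t ht htT).trans (mul_le_mul_of_nonneg_right (le_abs_self _) (by positivity))
    have b2 : (s + 1) ^ (k + d) ≤ 4 ^ (k + d) * (k + d).factorial * Real.exp (1 / 4) * Real.exp (s / 4) := by
      have := Real.pow_div_factorial_le_exp ((s + 1) / 4) (by positivity) (k + d)
      rw [div_le_iff₀ (by positivity), div_pow, div_le_iff₀ (by positivity)] at this
      rw [mul_assoc, ← Real.exp_add]
      have e2 : 1 / 4 + s / 4 = (s + 1) / 4 := by ring
      rw [e2]
      linarith
    have b3 : Gw t x = Real.exp (-((d : ℝ) / 2) * Real.log t) * Real.exp (-(s / 4)) := by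
      rw [Gw, ← Real.exp_add]; congr 1; rw [hsdef]; field_simp; ring
    have b4 : t ^ d * Real.exp (-((d : ℝ) / 2) * Real.log t) ≤ 1 := by
      have : t ^ d = Real.exp (d * Real.log t) := by
        rw [mul_comm, Real.exp_mul, Real.exp_log ht, Real.rpow_natCast]
      rw [this, ← Real.exp_add, Real.exp_le_one_iff]
      have := Real.log_nonpos ht.le ht1
      have hd : (0 : ℝ) ≤ d := Nat.cast_nonneg d
      nlinarith
    calc w (x, t) ^ 2 * Gw t x ≤ (|C| * (t * (s + 1)) ^ (k + d)) * Gw t x :=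
          mul_le_mul_of_nonneg_right b1 (Gw_pos _ _).le
      _ = |C| * t ^ (k + d) * (s + 1) ^ (k + d) * Gw t x := by rw [mul_pow]; ring
      _ ≤ |C| * t ^ (k + d) * (4 ^ (k + d) * (k + d).factorial * Real.exp (1 / 4) * Real.exp (s / 4)) * Gw t x := by
          have := (Gw_pos t x).le
          gcongr
      _ = A * t ^ k * (t ^ d * Real.exp (-((d : ℝ) / 2) * Real.log t)) * (Real.exp (s / 4) * Real.exp (-(s / 4))) := by
          rw [b3, hA, pow_add t]; ring
      _ = A * t ^ k * (t ^ d * Real.exp (-((d : ℝ) / 2) * Real.log t)) := by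
          rw [← Real.exp_add]; simp
      _ ≤ A * t ^ k * 1 := by gcongr
      _ = A * t ^ k := mul_one _
  · simp only [indicator_of_notMem hx, h0 x hx t]
    simp

theorem H_nonneg (w : ST d → ℝ) (t : ℝ) : 0 ≤ Hf w t :=
  integral_nonneg fun x => mul_nonneg (sq_nonneg _) (Gw_pos t x).le

theorem D_nonneg (w : ST d → ℝ) (t : ℝ) : 0 ≤ Df w t :=
  integral_nonneg fun x =>
    mul_nonneg (Finset.sum_nonneg fun _ _ => sq_nonneg _) (Gw_pos t x).le

set_option maxHeartbeats 2000000 in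
theorem core (hK : IsCompact K) (hw : ContDiff ℝ ∞ w) (h0 : OutZ K w) {M R T : ℝ} (hM : 0 ≤ M)
    (hT : 0 < T)
    (hF : ∀ x t, 0 < t → t < T → sq x < R →
      Ff w t x ^ 2 ≤ M * (w (x, t) ^ 2 + ∑ j, Dd (some j) w (x, t) ^ 2))
    (hp : ∀ k : ℕ, ∃ C : ℝ, ∀ x t, 0 < t → t < T → w (x, t) ^ 2 ≤ C * (sq x + t) ^ k)
    (x₁ : Fin d → ℝ) (hx₁ : sq x₁ < R) : w (x₁, 0) = 0 := by
  by_contra hne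
  obtain ⟨C1, hC1, hFb⟩ := F_bound hK hw h0 hM hF
  obtain ⟨q, c0, δ, hq0, hqR, hc0, hδ, hlow⟩ := H_lower hK hw h0 hx₁ hne
  set c : ℝ := 1 + 3 / 2 * M with hc
  have hcpos : 0 < c := by positivity
  have hRq : 0 < R - q := by linarith
  set C2 : ℝ := 3 / 2 * C1 with hC2
  have hC20 : 0 ≤ C2 := by positivity
  obtain ⟨τ, hτ0, hτ⟩ : ∃ τ : ℝ, 0 < τ ∧ (τ < T ∧ τ < δ ∧ τ ≤ 1 ∧ c * τ ≤ 1 / 2 ∧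
      C2 * τ ≤ c0 * (R - q) / 8) := by
    have ev : ∀ᶠ τ : ℝ in 𝓝[>] 0, τ < T ∧ τ < δ ∧ τ ≤ 1 ∧ c * τ ≤ 1 / 2 ∧
      C2 * τ ≤ c0 * (R - q) / 8 := by
      have c1 : Tendsto (fun τ : ℝ => c * τ) (𝓝[>] 0) (𝓝 0) := by
        have : Tendsto (fun τ : ℝ => c * τ) (𝓝 0) (𝓝 (c * 0)) := (continuous_const.mul continuous_id).tendsto 0
        rw [mul_zero] at this
        exact this.mono_left nhdsWithin_le_nhds
      have c2 : Tendsto (fun τ : ℝ => C2 * τ) (𝓝[>] 0) (𝓝 0) := by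
        have : Tendsto (fun τ : ℝ => C2 * τ) (𝓝 0) (𝓝 (C2 * 0)) := (continuous_const.mul continuous_id).tendsto 0
        rw [mul_zero] at this
        exact this.mono_left nhdsWithin_le_nhds
      have c3 : ∀ {a : ℝ}, 0 < a → ∀ᶠ τ : ℝ in 𝓝[>] 0, τ < a := fun ha =>
        (eventually_lt_nhds ha).filter_mono nhdsWithin_le_nhds
      filter_upwards [c3 hT, c3 hδ, c3 one_pos, c1.eventually (eventually_lt_nhds (show (0:ℝ) < 1/2 by norm_num)),
        c2.eventually (eventually_lt_nhds (show (0:ℝ) < c0 * (R - q) / 8 by positivity))]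
        with τ h1 h2 h3 h4 h5 using ⟨h1, h2, h3.le, h4.le, h5.le⟩
    obtain ⟨τ, h1, h2⟩ := (ev.and self_mem_nhdsWithin).exists
    exact ⟨τ, h2, h1⟩
  obtain ⟨hτT, hτδ, hτ1, hcτ, hC2τ⟩ := hτ
  -- derivative estimate
  have key : ∀ α : ℝ, 0 ≤ α → 2 + 3 / 2 * M ≤ α / 2 → ∀ t, 0 < t → t ≤ τ →
      ∃ k : ℝ, HasDerivAt (Qf w c α) (Real.exp (-2 * α * (Real.log t - c * t)) * k) t ∧
        k ≤ -(c0 / 2) * gq d q t := by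
    intro α hα hα2 t ht htτ
    have hct : c * t ≤ 1 / 2 := (mul_le_mul_of_nonneg_left htτ hcpos.le).trans hcτ
    have ht1 : t ≤ 1 := htτ.trans hτ1
    obtain ⟨k, hk, hk2⟩ := Qf_deriv hK hw h0 ht ht1 hcpos.le hct hα
    refine ⟨k, hk, hk2.trans ?_⟩
    have hF1 := hFb t ht (htτ.trans_lt hτT) ht1
    have hH0 := H_nonneg w t
    have hD0 := D_nonneg w t
    have hl := hlow t ht (htτ.trans_lt hτδ)
    have hg := (gq_pos (d := d) R t).le
    have hgq := (gq_pos (d := d) q t).le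
    have g1 : gq d R t = gq d q t * Real.exp (-((R - q) / (4 * t))) := by
      rw [gq, gq, ← Real.exp_add]; congr 1; ring
    have g2 : C2 * Real.exp (-((R - q) / (4 * t))) ≤ c0 / 2 := by
      rw [Real.exp_neg, ← div_eq_mul_inv, div_le_iff₀ (Real.exp_pos _)]
      have h1 := Real.add_one_le_exp ((R - q) / (4 * t))
      have h2 : C2 ≤ c0 / 2 * ((R - q) / (4 * t)) := by
        have : c0 / 2 * ((R - q) / (4 * t)) = (c0 * (R - q) / 8) / t := by field_simp; norm_num
        rw [this, le_div_iff₀ ht]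
        exact (mul_le_mul_of_nonneg_left htτ hC20).trans hC2τ
      refine h2.trans (mul_le_mul_of_nonneg_left (by linarith) (by positivity))
    have g3 : C2 * gq d R t ≤ c0 / 2 * gq d q t := by
      rw [g1]
      have := mul_le_mul_of_nonneg_right g2 hgq
      linarith
    have m1 : 3 / 2 * t * (∫ x, Ff w t x ^ 2 * Gw t x) ≤
        3 / 2 * t * (M * (Hf w t + Df w t) + C1 * gq d R t) :=
      mul_le_mul_of_nonneg_left hF1 (by positivity)
    have m2 : t * (3 / 2 * M * Hf w t) ≤ 1 * (3 / 2 * M * Hf w t) :=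
      mul_le_mul_of_nonneg_right ht1 (by positivity)
    have m3 : t * (C2 * gq d R t) ≤ 1 * (C2 * gq d R t) :=
      mul_le_mul_of_nonneg_right ht1 (by positivity)
    have m4 : (2 + 3 / 2 * M) * Hf w t ≤ α / 2 * Hf w t := mul_le_mul_of_nonneg_right hα2 hH0
    have e1 : 3 / 2 * t * (M * (Hf w t + Df w t) + C1 * gq d R t) - (c - 1) * t * Df w t =
      t * (3 / 2 * M * Hf w t) + t * (C2 * gq d R t) := by
      rw [hc, hC2]; ring
    have e2 : (2 + 3 / 2 * M) * Hf w t = 2 * Hf w t + 3 / 2 * M * Hf w t := by ring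
    have e3 : (1 - α / 2) * Hf w t = Hf w t - α / 2 * Hf w t := by ring
    have e4 : c0 * gq d q t = c0 / 2 * gq d q t + c0 / 2 * gq d q t := by ring
    rw [e3]
    linarith
  set g0 : ℝ := Real.exp (-(q / τ)) with hg0
  have hg0pos : 0 < g0 := Real.exp_pos _
  set h1 : ℝ := Real.log (τ / 2) - c * (τ / 2) with hh1
  set h2 : ℝ := Real.log τ - c * τ with hh2
  have hgap : 1 / 4 ≤ h2 - h1 := by
    rw [hh1, hh2, Real.log_div hτ0.ne' two_ne_zero]
    have := Real.log_two_gt_d9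
    linarith
  set μ : ℝ := c0 / 2 * g0 * (τ / 4) with hμ
  have hμ0 : 0 < μ := by positivity
  have final : ∀ n : ℕ, 2 + 3 / 2 * M ≤ (n : ℝ) / 2 →
      μ * Real.exp (-2 * n * h1) ≤ 2 * τ * Df w τ * Real.exp (-2 * n * h2) := by
    intro n hn
    have hn0 : (0 : ℝ) ≤ n := Nat.cast_nonneg n
    have key := key n hn0 hn
    have hdiff : ∀ t, 0 < t → t ≤ τ → DifferentiableAt ℝ (Qf w c n) t := fun t h h' => by
      obtain ⟨k, hk, _⟩ := key t h h'
      exact hk.differentiableAt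
    have hder : ∀ t, 0 < t → t ≤ τ → deriv (Qf w c n) t ≤
        -(c0 / 2) * gq d q t * Real.exp (-2 * n * (Real.log t - c * t)) := fun t h h' => by
      obtain ⟨k, hk, hk2⟩ := key t h h'
      rw [hk.deriv, mul_comm]
      exact mul_le_mul_of_nonneg_right hk2 (Real.exp_pos _).le
    have hanti : ∀ s t, 0 < s → s ≤ t → t ≤ τ → Qf w c n t ≤ Qf w c n s := by
      intro s t hs hst htτ
      have := (convex_Icc s t).image_sub_le_mul_sub_of_deriv_le (f := Qf w c n) (C := 0)
        (fun y hy => (hdiff y (hs.trans_le hy.1) (hy.2.trans htτ)).continuousAt.continuousWithinAt)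
        (fun y hy => by
          have hy := interior_subset hy
          exact (hdiff y (hs.trans_le hy.1) (hy.2.trans htτ)).differentiableWithinAt)
        (fun y hy => by
          have hy := interior_subset hy
          refine (hder y (hs.trans_le hy.1) (hy.2.trans htτ)).trans ?_
          have := mul_nonneg (mul_nonneg (half_pos hc0).le (gq_pos (d := d) q y).le)
            (Real.exp_pos (-2 * n * (Real.log y - c * y))).le
          linarith)
        s (left_mem_Icc.2 hst) t (right_mem_Icc.2 hst) hst
      linarith
    -- Q ≤ 0 near zero
    have hQ0 : Qf w c n (τ / 4) ≤ 0 := by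
      obtain ⟨C, hC0, hC⟩ := H_upper hK hw h0 hp (2 * n + 1)
      set B : ℝ := Real.exp (2 * n * c) * ((n + 1) * C) with hB
      have hQs : ∀ s, 0 < s → s ≤ τ / 4 → Qf w c n (τ / 4) ≤ B * s := by
        intro s hs hsτ
        refine (hanti s (τ / 4) hs hsτ (by linarith)).trans ?_
        have hs1 : s ≤ 1 := by linarith
        have hH := hC s hs (by linarith) hs1
        have hH0 := H_nonneg w s
        have hcs : c * s ≤ 1 / 2 := by
          have : c * s ≤ c * τ := mul_le_mul_of_nonneg_left (by linarith) hcpos.le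
          linarith
        have i1 : n * Hf w s - s / (1 - c * s) * Df w s + s / 2 * Hf w s ≤ (n + 1) * Hf w s := by
          have : 0 ≤ s / (1 - c * s) * Df w s :=
            mul_nonneg (div_nonneg hs.le (by linarith)) (D_nonneg w s)
          nlinarith
        have i2 : Real.exp (-2 * n * (Real.log s - c * s)) * s ^ (2 * n) ≤ Real.exp (2 * n * c) := by
          have : s ^ (2 * n) = Real.exp (2 * n * Real.log s) := by
            rw [mul_comm (2 * (n:ℝ)), Real.exp_mul, Real.exp_log hs]
            exact_mod_cast (Real.rpow_natCast s (2 * n)).symm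
          rw [this, ← Real.exp_add]
          apply Real.exp_le_exp.2
          have : c * s ≤ c * 1 := mul_le_mul_of_nonneg_left hs1 hcpos.le
          nlinarith
        calc Qf w c n s ≤ Real.exp (-2 * n * (Real.log s - c * s)) * ((n + 1) * Hf w s) :=
              mul_le_mul_of_nonneg_left i1 (Real.exp_pos _).le
          _ ≤ Real.exp (-2 * n * (Real.log s - c * s)) * ((n + 1) * (C * s ^ (2 * n + 1))) := by
              gcongr
          _ = (Real.exp (-2 * n * (Real.log s - c * s)) * s ^ (2 * n)) * ((n + 1) * C * s) := by
              rw [pow_succ]; ring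
          _ ≤ Real.exp (2 * n * c) * ((n + 1) * C * s) := by gcongr
          _ = B * s := by rw [hB]; ring
      have ht : Tendsto (fun s : ℝ => B * s) (𝓝[>] 0) (𝓝 0) := by
        have : Tendsto (fun τ : ℝ => B * τ) (𝓝 0) (𝓝 (B * 0)) :=
          (continuous_const.mul continuous_id).tendsto 0
        rw [mul_zero] at this
        exact this.mono_left nhdsWithin_le_nhds
      refine ge_of_tendsto ht ?_
      filter_upwards [self_mem_nhdsWithin,
        (eventually_lt_nhds (show (0:ℝ) < τ / 4 by positivity)).filter_mono nhdsWithin_le_nhds] with s a1 a2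
      exact hQs s a1 a2.le
    have hE : 0 < Real.exp (-2 * n * h1) := Real.exp_pos _
    have hMVT := (convex_Icc (τ / 4) (τ / 2)).image_sub_le_mul_sub_of_deriv_le (f := Qf w c n)
        (C := -(c0 / 2 * g0 * Real.exp (-2 * n * h1)))
        (fun y hy => (hdiff y (by linarith [hy.1]) (by linarith [hy.2])).continuousAt.continuousWithinAt)
        (fun y hy => by
          have hy := interior_subset hy
          exact (hdiff y (by linarith [hy.1]) (by linarith [hy.2])).differentiableWithinAt)
        (fun y hy => by
          have hy := interior_subset hy
          have hy0 : 0 < y := by linarith [hy.1]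
          refine (hder y hy0 (by linarith [hy.2])).trans ?_
          have a1 : g0 ≤ gq d q y := by
            rw [hg0, gq]
            apply Real.exp_le_exp.2
            have l := Real.log_nonpos hy0.le (by linarith [hy.2])
            have hd : (0 : ℝ) ≤ d := Nat.cast_nonneg d
            have l2 : q / (4 * y) ≤ q / τ := div_le_div_of_nonneg_left hq0 hτ0 (by linarith [hy.1])
            nlinarith
          have a2 : Real.exp (-2 * n * h1) ≤ Real.exp (-2 * n * (Real.log y - c * y)) := by
            apply Real.exp_le_exp.2
            have : Real.log y - c * y ≤ h1 := by
              rw [hh1]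
              have b1 := Real.log_le_sub_one_of_pos (show 0 < y / (τ / 2) by positivity)
              rw [Real.log_div hy0.ne' (by positivity)] at b1
              have b2 : y / (τ / 2) - 1 = (y - τ / 2) * (2 / τ) := by field_simp
              have b3 : c ≤ 2 / τ := by
                rw [le_div_iff₀ hτ0]; linarith
              have b4 : (y - τ / 2) * (2 / τ) ≤ (y - τ / 2) * c :=
                mul_le_mul_of_nonpos_left b3 (by linarith [hy.2])
              linarith
            nlinarith
          have := mul_le_mul (mul_le_mul_of_nonneg_left a1 (half_pos hc0).le) a2 hE.le
            (mul_nonneg (half_pos hc0).le (gq_pos (d := d) q y).le)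
          linarith)
        (τ / 4) (left_mem_Icc.2 (by linarith)) (τ / 2) (right_mem_Icc.2 (by linarith)) (by linarith)
    have hQ2 : Qf w c n τ ≤ - (μ * Real.exp (-2 * n * h1)) := by
      have := hanti (τ / 2) τ (by positivity) (by linarith) le_rfl
      have e : -(c0 / 2 * g0 * Real.exp (-2 * n * h1)) * (τ / 2 - τ / 4) =
        - (μ * Real.exp (-2 * n * h1)) := by rw [hμ]; ring
      linarith
    have hQ3 : -(2 * τ * Df w τ * Real.exp (-2 * n * h2)) ≤ Qf w c n τ := by
      have hD := D_nonneg w τ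
      have hH := H_nonneg w τ
      have θ : τ / (1 - c * τ) ≤ 2 * τ := by
        rw [div_le_iff₀ (by linarith)]; nlinarith
      have i1 : -(2 * τ * Df w τ) ≤ n * Hf w τ - τ / (1 - c * τ) * Df w τ + τ / 2 * Hf w τ := by
        have a1 := mul_le_mul_of_nonneg_right θ hD
        have a2 : 0 ≤ n * Hf w τ := by positivity
        have a3 : 0 ≤ τ / 2 * Hf w τ := by positivity
        linarith
      have := mul_le_mul_of_nonneg_left i1 (Real.exp_pos (-2 * n * h2)).le
      rw [Qf, ← hh2]
      linarith
    linarith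
  -- contradiction for large n
  obtain ⟨n, hn⟩ := exists_nat_gt (max (2 * (2 + 3 / 2 * M)) (2 * (2 * τ * Df w τ / μ)))
  have hn1 : 2 + 3 / 2 * M ≤ (n : ℝ) / 2 := by
    have := (le_max_left _ _).trans_lt hn
    linarith
  have hn2 : 2 * τ * Df w τ / μ < n / 2 := by
    have := (le_max_right _ _).trans_lt hn
    linarith
  have hf := final n hn1
  rw [div_lt_iff₀ hμ0] at hn2
  have hE2 : 0 < Real.exp (-2 * n * h2) := Real.exp_pos _
  have r : Real.exp (-2 * n * h1) = Real.exp (-2 * n * h2) * Real.exp (2 * n * (h2 - h1)) := by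
    rw [← Real.exp_add]; congr 1; ring
  have hb : (n : ℝ) / 2 ≤ Real.exp (2 * n * (h2 - h1)) := by
    have := Real.add_one_le_exp (2 * n * (h2 - h1))
    have hn0 : (0 : ℝ) ≤ n := Nat.cast_nonneg n
    nlinarith
  rw [r] at hf
  have hf2 : μ * Real.exp (2 * n * (h2 - h1)) ≤ 2 * τ * Df w τ := by
    have : Real.exp (-2 * n * h2) * (μ * Real.exp (2 * n * (h2 - h1))) ≤ Real.exp (-2 * n * h2) * (2 * τ * Df w τ) := by linarith
    exact le_of_mul_le_mul_left this hE2
  have := mul_le_mul_of_nonneg_left hb hμ0.le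
  linarith

end core
end Nodal


open scoped ContDiff Topology
open Filter

namespace Nodal
section sucp
variable {d : ℕ} {P : Set (ST d)}

/-- Time reflection around a point. -/
def refl (p q : ST d) : ST d := (p.1 + q.1, p.2 - q.2)

theorem refl_contDiff (p : ST d) : ContDiff ℝ ∞ (refl p) := by
  unfold refl
  fun_prop

/-- Sign of a direction. -/
def sgn : Option (Fin d) → ℝ
  | none => -1
  | some _ => 1

theorem refl_hasFDerivAt (p q : ST d) :
    HasFDerivAt (refl p) ((ContinuousLinearMap.fst ℝ (Fin d → ℝ) ℝ).prod
      (-(ContinuousLinearMap.snd ℝ (Fin d → ℝ) ℝ))) q := by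
  have h1 : HasFDerivAt (fun q : ST d => p.1 + q.1) (ContinuousLinearMap.fst ℝ (Fin d → ℝ) ℝ) q :=
    hasFDerivAt_fst.const_add _
  have h2 : HasFDerivAt (fun q : ST d => p.2 - q.2) (-ContinuousLinearMap.snd ℝ (Fin d → ℝ) ℝ) q :=
    hasFDerivAt_snd.const_sub _
  exact h1.prodMk h2

theorem Dd_refl {f : ST d → ℝ} {p q : ST d} (hf : DifferentiableAt ℝ f (refl p q))
    (o : Option (Fin d)) : Dd o (fun z => f (refl p z)) q = sgn o * Dd o f (refl p q) := by
  have h := hf.hasFDerivAt.comp q (refl_hasFDerivAt p q)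
  have h' : HasFDerivAt (fun z => f (refl p z)) _ q := h
  simp only [Dd]
  rw [h'.fderiv]
  cases o with
  | none =>
    have : ((0 : Fin d → ℝ), (-1 : ℝ)) = -bas none := by simp [bas]
    simp only [bas, ContinuousLinearMap.comp_apply, ContinuousLinearMap.prod_apply, sgn]
    simp only [ContinuousLinearMap.neg_apply, ContinuousLinearMap.coe_fst',
      ContinuousLinearMap.coe_snd']
    rw [this, map_neg]
    simp [bas]
  | some i => simp [bas, sgn]

theorem norm_sq_le_sq (x : Fin d → ℝ) : ‖x‖ ^ 2 ≤ sq x := by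
  have h : ‖x‖ ≤ Real.sqrt (sq x) := by
    rw [pi_norm_le_iff_of_nonneg (Real.sqrt_nonneg _)]
    intro i
    rw [Real.norm_eq_abs]
    apply Real.abs_le_sqrt
    exact Finset.single_le_sum (f := fun i => x i ^ 2) (fun i _ => sq_nonneg _) (Finset.mem_univ i)
  calc ‖x‖ ^ 2 ≤ Real.sqrt (sq x) ^ 2 := by gcongr
    _ = sq x := Real.sq_sqrt (sq_nonneg' x)

theorem sucp (hP : IsOpen P) {V A : ST d → ℝ} {B : Fin d → ST d → ℝ} (hV : ContDiffOn ℝ ∞ V P)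
    (hA : ContDiffOn ℝ ∞ A P) (hB : ∀ i, ContDiffOn ℝ ∞ (B i) P)
    (heq : ∀ q ∈ P, Dd none V q = ∑ i, Dd (some i) (Dd (some i) V) q + A q * V q
      + ∑ i, B i q * Dd (some i) V q)
    {p : ST d} (hp : p ∈ P) (hO : ∀ m, Ord m V p) :
    ∃ U : Set (Fin d → ℝ), IsOpen U ∧ p.1 ∈ U ∧ ∀ x ∈ U, (x, p.2) ∈ P ∧ V (x, p.2) = 0 := by
  obtain ⟨R0, hR0, hball⟩ := Metric.isOpen_iff.1 hP p hp
  set R := R0 / 2 with hR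
  have hRpos : 0 < R := by positivity
  have hRlt : R < R0 := by rw [hR]; linarith
  have hnorm : ∀ q : ST d, dist (refl p q) p = ‖q‖ := by
    intro q
    rw [dist_eq_norm, refl, Prod.norm_def, Prod.norm_def]
    simp
  have hmem : ∀ q : ST d, ‖q‖ < R0 → refl p q ∈ P := fun q hq => hball (by
    rw [Metric.mem_ball, hnorm]; exact hq)
  let χ : ContDiffBump (0 : ST d) := ⟨R / 2, R, by positivity, by linarith⟩
  have hχ1 : ∀ q : ST d, ‖q‖ ≤ R / 2 → χ q = 1 := fun q hq =>
    χ.one_of_mem_closedBall (by simpa using hq)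
  have hχ0 : ∀ q : ST d, R ≤ ‖q‖ → χ q = 0 := fun q hq =>
    χ.zero_of_le_dist (by simpa using hq)
  set w : ST d → ℝ := fun q => χ q * V (refl p q) with hwdef
  have hwz : ∀ q : ST d, R ≤ ‖q‖ → w q = 0 := fun q hq => by simp [hwdef, hχ0 q hq]
  have hVd : ∀ q : ST d, ‖q‖ < R0 → ContDiffAt ℝ ∞ (fun z => V (refl p z)) q := fun q hq =>
    (hV.contDiffAt (hP.mem_nhds (hmem q hq))).comp q (refl_contDiff p).contDiffAt
  have hw : ContDiff ℝ ∞ w := by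
    rw [contDiff_iff_contDiffAt]
    intro q
    by_cases hq : ‖q‖ < R0
    · exact χ.contDiffAt.mul (hVd q hq)
    · have : w =ᶠ[𝓝 q] fun _ => 0 := by
        have : {z : ST d | R < ‖z‖} ∈ 𝓝 q :=
          (isOpen_lt continuous_const continuous_norm).mem_nhds (by
            simp only [mem_setOf_eq]; linarith)
        filter_upwards [this] with z hz using hwz z (le_of_lt hz)
      exact contDiffAt_const.congr_of_eventuallyEq this
  have hK : IsCompact (Metric.closedBall (0 : Fin d → ℝ) R) := isCompact_closedBall _ _
  have h0 : OutZ (Metric.closedBall (0 : Fin d → ℝ) R) w := by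
    intro x hx t
    apply hwz
    rw [mem_closedBall_zero_iff, not_le] at hx
    exact hx.le.trans (norm_fst_le (x, t))
  -- derivatives of w in the inner ball
  have hBo : IsOpen (Metric.ball (0 : ST d) (R / 2)) := Metric.isOpen_ball
  have hin : ∀ q ∈ Metric.ball (0 : ST d) (R / 2), ‖q‖ < R / 2 := fun q hq => by simpa using hq
  have e0 : EqOn w (fun z => V (refl p z)) (Metric.ball (0 : ST d) (R / 2)) := fun q hq => by
    simp [hwdef, hχ1 q (hin q hq).le]
  have e1 : ∀ o, EqOn (Dd o w) (fun z => sgn o * Dd o V (refl p z))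
      (Metric.ball (0 : ST d) (R / 2)) := fun o q hq => by
    rw [Dd_congr hBo e0 o hq]
    have hq' := hin q hq
    exact Dd_refl (smooth_diffAt hP hV (hmem q (by linarith))) o
  have e2 : ∀ i : Fin d, EqOn (Dd (some i) (Dd (some i) w))
      (fun z => Dd (some i) (Dd (some i) V) (refl p z))
      (Metric.ball (0 : ST d) (R / 2)) := fun i q hq => by
    have e1' : EqOn (Dd (some i) w) (fun z => Dd (some i) V (refl p z))
      (Metric.ball (0 : ST d) (R / 2)) := fun q hq => by rw [e1 _ hq]; simp [sgn]
    rw [Dd_congr hBo e1' (some i) hq]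
    have hq' := hin q hq
    rw [Dd_refl (smooth_diffAt hP (Dd_smooth hP hV _) (hmem q (by linarith)))]
    simp [sgn]
  -- coefficient bound
  obtain ⟨N, hN⟩ : ∃ N, ∀ q ∈ Metric.closedBall p R, ‖A q ^ 2 + ∑ i, B i q ^ 2‖ ≤ N := by
    refine (isCompact_closedBall p R).exists_bound_of_continuousOn ?_
    have hsub : Metric.closedBall p R ⊆ P := fun q hq =>
      hball (Metric.closedBall_subset_ball hRlt hq)
    refine ContinuousOn.mono ?_ hsub
    exact (hA.continuousOn.pow 2).add (continuousOn_finsetSum _ fun i _ => (hB i).continuousOn.pow 2)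
  have hN0 : 0 ≤ N := (norm_nonneg _).trans (hN p (Metric.mem_closedBall_self hRpos.le))
  set T := min (R / 2) 1 with hT
  have hTpos : 0 < T := lt_min (by positivity) one_pos
  have hTR : T ≤ R / 2 := min_le_left _ _
  have hT1 : T ≤ 1 := min_le_right _ _
  have hx_of_sq : ∀ x : Fin d → ℝ, sq x < (R / 2) ^ 2 → ‖x‖ < R / 2 := fun x hx =>
    lt_of_pow_lt_pow_left₀ 2 (by positivity) ((norm_sq_le_sq x).trans_lt hx)
  have hF : ∀ x t, 0 < t → t < T → sq x < (R / 2) ^ 2 →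
      Ff w t x ^ 2 ≤ 2 * N * (w (x, t) ^ 2 + ∑ j, Dd (some j) w (x, t) ^ 2) := by
    intro x t ht htT hx
    have hxn := hx_of_sq x hx
    have hq : ((x, t) : ST d) ∈ Metric.ball (0 : ST d) (R / 2) := by
      rw [mem_ball_zero_iff, Prod.norm_def]
      refine max_lt hxn ?_
      simp only [Real.norm_eq_abs, abs_of_pos ht]
      linarith
    have hq' := hin _ hq
    have hFe : Ff w t x = -(A (refl p (x, t)) * w (x, t)
        + ∑ i, B i (refl p (x, t)) * Dd (some i) w (x, t)) := by
      rw [Ff, e1 none hq, Finset.sum_congr rfl fun i _ => e2 i hq, e0 hq,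
        Finset.sum_congr rfl fun i _ => congrArg (B i (refl p (x, t)) * ·) (e1 (some i) hq)]
      simp only [sgn, heq _ (hmem (x, t) (by linarith))]
      simp only [one_mul]
      ring
    rw [hFe, neg_sq]
    have hNq := (le_abs_self _).trans (hN (refl p (x, t)) (by
      rw [Metric.mem_closedBall, hnorm]; linarith))
    have hsB : 0 ≤ ∑ i, B i (refl p (x, t)) ^ 2 := Finset.sum_nonneg fun _ _ => sq_nonneg _
    have hsD : 0 ≤ ∑ j, Dd (some j) w (x, t) ^ 2 := Finset.sum_nonneg fun _ _ => sq_nonneg _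
    have cs := Finset.sum_mul_sq_le_sq_mul_sq Finset.univ (fun i => B i (refl p (x, t)))
      (fun i => Dd (some i) w (x, t))
    have hA2 := sq_nonneg (A (refl p (x, t)))
    have t1 : A (refl p (x, t)) ^ 2 * w (x, t) ^ 2 ≤ N * w (x, t) ^ 2 :=
      mul_le_mul_of_nonneg_right (by linarith) (sq_nonneg _)
    have t2 := mul_le_mul_of_nonneg_right (show ∑ i, B i (refl p (x, t)) ^ 2 ≤ N by linarith) hsD
    have t3 := add_sq_le (a := A (refl p (x, t)) * w (x, t))
      (b := ∑ i, B i (refl p (x, t)) * Dd (some i) w (x, t))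
    rw [mul_pow] at t3
    linarith
  have hpow : ∀ k : ℕ, ∃ C : ℝ, ∀ x t, 0 < t → t < T → w (x, t) ^ 2 ≤ C * (sq x + t) ^ k := by
    intro k
    obtain ⟨C, r, hC, hr, _, hb⟩ := Ord_bound hP hp hV (hO k)
    obtain ⟨Bw, hBw⟩ : ∃ Bw, ∀ q ∈ Metric.closedBall (0 : ST d) R, ‖w q ^ 2‖ ≤ Bw :=
      (isCompact_closedBall _ _).exists_bound_of_continuousOn (hw.continuous.pow 2).continuousOn
    have hBw0 : 0 ≤ Bw := (norm_nonneg _).trans (hBw 0 (Metric.mem_closedBall_self hRpos.le))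
    refine ⟨C ^ 2 + Bw / (r ^ 2) ^ k, fun x t ht htT => ?_⟩
    have hqs : ‖((x, t) : ST d)‖ ^ 2 ≤ sq x + t := by
      rw [Prod.norm_def]
      have := norm_sq_le_sq x
      have hs := sq_nonneg' x
      rcases max_choice ‖(x, t).1‖ ‖(x, t).2‖ with h | h
      · rw [h]; simp only; linarith
      · rw [h]; simp only [Real.norm_eq_abs, sq_abs]; nlinarith
    have hst : 0 ≤ sq x + t := (sq_nonneg _).trans hqs
    by_cases hqr : ‖((x, t) : ST d)‖ < r
    · have h1 := hb (refl p (x, t)) (by rw [Metric.mem_ball, hnorm]; exact hqr)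
      rw [← dist_eq_norm, hnorm] at h1
      have h2 : |w (x, t)| ≤ C * ‖((x, t) : ST d)‖ ^ k := by
        rw [hwdef]
        simp only [abs_mul]
        rw [abs_of_nonneg χ.nonneg]
        calc χ (x, t) * |V (refl p (x, t))| ≤ 1 * |V (refl p (x, t))| :=
              mul_le_mul_of_nonneg_right χ.le_one (abs_nonneg _)
          _ ≤ _ := by rw [one_mul]; exact h1
      calc w (x, t) ^ 2 = |w (x, t)| ^ 2 := (sq_abs _).symm
        _ ≤ (C * ‖((x, t) : ST d)‖ ^ k) ^ 2 := by gcongr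
        _ = C ^ 2 * (‖((x, t) : ST d)‖ ^ 2) ^ k := by ring
        _ ≤ C ^ 2 * (sq x + t) ^ k := by gcongr
        _ ≤ _ := by
          refine mul_le_mul_of_nonneg_right ?_ (by positivity)
          have : 0 ≤ Bw / (r ^ 2) ^ k := by positivity
          linarith
    · push Not at hqr
      have h1 : w (x, t) ^ 2 ≤ Bw := by
        by_cases hR' : ‖((x, t) : ST d)‖ ≤ R
        · exact (le_abs_self _).trans (hBw (x, t) (by simpa using hR'))
        · rw [hwz (x, t) (le_of_not_ge hR')]; simpa using hBw0
      have h2 : r ^ 2 ≤ sq x + t := le_trans (by gcongr) hqs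
      calc w (x, t) ^ 2 ≤ Bw := h1
        _ = Bw / (r ^ 2) ^ k * (r ^ 2) ^ k := by field_simp
        _ ≤ Bw / (r ^ 2) ^ k * (sq x + t) ^ k := by gcongr
        _ ≤ _ := by
          refine mul_le_mul_of_nonneg_right ?_ (by positivity)
          have := sq_nonneg C
          linarith
  have hcore := core hK hw h0 (by positivity) hTpos hF hpow
  refine ⟨{y | sq (y - p.1) < (R / 2) ^ 2}, ?_, ?_, ?_⟩
  · exact isOpen_lt ((sq_contDiff (n := 1)).continuous.comp (by fun_prop)) continuous_const
  · simp only [mem_setOf_eq, sub_self, sq]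
    simp only [Pi.zero_apply]
    simp; positivity
  · intro y hy
    have hn := hx_of_sq _ hy
    have hq : ‖((y - p.1, 0) : ST d)‖ < R / 2 := by
      rw [Prod.norm_def]
      exact max_lt hn (by simpa using hRpos)
    have hr : refl p (y - p.1, 0) = (y, p.2) := by simp [refl]
    refine ⟨hr ▸ hmem _ (by linarith), ?_⟩
    have := hcore (y - p.1) hy
    rw [hwdef] at this
    simp only [hr, hχ1 _ hq.le, one_mul] at this
    exact this

theorem finite_order {Ω : Set (Fin d → ℝ)} {I : Set ℝ} (hΩ : IsOpen Ω) (hΩc : IsPreconnected Ω) (hI : IsOpen I)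
    {V A : ST d → ℝ} {B : Fin d → ST d → ℝ} (hV : ContDiffOn ℝ ∞ V (Ω ×ˢ I))
    (hA : ContDiffOn ℝ ∞ A (Ω ×ˢ I)) (hB : ∀ i, ContDiffOn ℝ ∞ (B i) (Ω ×ˢ I))
    (heq : ∀ q ∈ Ω ×ˢ I, Dd none V q = ∑ i, Dd (some i) (Dd (some i) V) q + A q * V q
      + ∑ i, B i q * Dd (some i) V q)
    (hnt : ¬ ∃ t ∈ I, ∀ x ∈ Ω, V (x, t) = 0) {p : ST d} (hp : p ∈ Ω ×ˢ I) :
    ∃ m, ¬ Ord m V p := by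
  by_contra hcon
  push Not at hcon
  have hP : IsOpen (Ω ×ˢ I) := hΩ.prod hI
  apply hnt
  refine ⟨p.2, hp.2, ?_⟩
  set S : Set (Fin d → ℝ) := {x | x ∈ Ω ∧ ∀ m, Ord m V (x, p.2)} with hS
  have hSo : IsOpen S := by
    rw [isOpen_iff_mem_nhds]
    rintro x ⟨hx, hO⟩
    obtain ⟨U, hU, hxU, hUz⟩ := sucp hP hV hA hB heq (p := (x, p.2)) ⟨hx, hp.2⟩ hO
    filter_upwards [hU.mem_nhds hxU] with y hy
    exact ⟨(hUz y hy).1.1, fun m => flat_of_slice hP hU (fun z hz => (hUz z hz).1) hV hA hB heq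
      (fun z hz => (hUz z hz).2) hy m⟩
  have hSc : IsOpen {x | x ∈ Ω ∧ ¬ ∀ m, Ord m V (x, p.2)} := by
    have : {x | x ∈ Ω ∧ ¬ ∀ m, Ord m V (x, p.2)} =
        ⋃ l : List (Option (Fin d)), {x | x ∈ Ω ∧ Dw l V (x, p.2) ≠ 0} := by
      ext x
      simp only [mem_setOf_eq, mem_iUnion, exists_and_left]
      refine and_congr_right fun hx => ?_
      constructor
      · intro h
        by_contra hc
        push Not at hc
        exact h fun m => Ord_iff_Dw.2 fun l _ => hc l
      · rintro ⟨l, hl⟩ h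
        exact hl (Ord_iff_Dw.1 (h (l.length + 1)) l (Nat.lt_succ_self _))
    rw [this]
    refine isOpen_iUnion fun l => ?_
    have hc : ContinuousOn (fun x : Fin d → ℝ => Dw l V (x, p.2)) Ω :=
      (Dw_smooth hP hV l).continuousOn.comp (by fun_prop) fun x hx => ⟨hx, hp.2⟩
    exact hc.isOpen_inter_preimage hΩ isOpen_ne
  have hsub : Ω ⊆ S := by
    have := hΩc.subset_or_subset hSo hSc
      (Set.disjoint_left.2 fun x h1 h2 => h2.2 h1.2)
      (fun x hx => by
        by_cases h : ∀ m, Ord m V (x, p.2)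
        · exact Or.inl ⟨hx, h⟩
        · exact Or.inr ⟨hx, h⟩)
    rcases this with h | h
    · exact h
    · exact absurd hcon (h hp.1).2
  intro x hx
  exact ((hsub hx).2 1).1

end sucp
end Nodal


open scoped ContDiff Topology
open Filter

namespace Nodal
section meagre
variable {d : ℕ} {P : Set (ST d)}

theorem meagre_proj {J : Type*} {O : Set (ST d)} (hO : IsOpen O) (g : J → ST d → ℝ)
    (hg : ∀ j, ContinuousOn (g j) O)
    (h : ∀ p ∈ O, (∀ j, g j p = 0) → ∃ W ∈ 𝓝 p, ∀ U : Set (Fin d → ℝ), IsOpen U → U.Nonempty →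
      (∀ x ∈ U, ∃ t, (x, t) ∈ W ∧ (x, t) ∈ O ∧ ∀ j, g j (x, t) = 0) → False) :
    IsMeagre (Prod.fst '' {q : ST d | q ∈ O ∧ ∀ j, g j q = 0}) := by
  set S := {q : ST d | q ∈ O ∧ ∀ j, g j q = 0} with hS
  have loc : ∀ p ∈ S, ∃ C ∈ 𝓝[S] p, IsNowhereDense (Prod.fst '' C) := by
    rintro p ⟨hpO, hpg⟩
    obtain ⟨W, hW, hWU⟩ := h p hpO hpg
    obtain ⟨r, hr, hrs⟩ := Metric.nhds_basis_closedBall.mem_iff.1 (inter_mem (hO.mem_nhds hpO) hW)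
    set C := ⋂ j : Option J, Metric.closedBall p r ∩
      (match j with | none => univ | some j => g j ⁻¹' {0}) with hC
    have hCm : ∀ q, q ∈ C ↔ q ∈ Metric.closedBall p r ∧ ∀ j, g j q = 0 := by
      intro q
      simp only [hC, mem_iInter]
      constructor
      · intro h
        exact ⟨(h none).1, fun j => (h (some j)).2⟩
      · rintro ⟨h1, h2⟩ (_ | j)
        · exact ⟨h1, trivial⟩
        · exact ⟨h1, h2 j⟩
    have hCc : IsClosed C := by
      refine isClosed_iInter fun j => ?_
      cases j with
      | none => simpa using Metric.isClosed_closedBall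
      | some j =>
        exact ((hg j).mono (hrs.trans inter_subset_left)).preimage_isClosed_of_isClosed
          Metric.isClosed_closedBall isClosed_singleton
    have hCk : IsCompact C := (isCompact_closedBall p r).of_isClosed_subset hCc
      fun q hq => ((hCm q).1 hq).1
    refine ⟨C, ?_, ?_⟩
    · filter_upwards [self_mem_nhdsWithin, mem_nhdsWithin_of_mem_nhds (Metric.closedBall_mem_nhds p hr)]
        with q hq hq2
      exact (hCm q).2 ⟨hq2, hq.2⟩
    · rw [(hCk.image continuous_fst).isClosed.isNowhereDense_iff]
      by_contra hne
      rw [← ne_eq, ← nonempty_iff_ne_empty] at hne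
      refine hWU _ isOpen_interior hne fun x hx => ?_
      obtain ⟨⟨y, t⟩, hq, rfl⟩ := interior_subset hx
      have := (hCm _).1 hq
      exact ⟨t, (hrs this.1).2, (hrs this.1).1, this.2⟩
  choose! C hC1 hC2 using loc
  obtain ⟨T, hTS, hTc, hcov⟩ := TopologicalSpace.countable_cover_nhdsWithin hC1
  rw [isMeagre_iff_countable_union_isNowhereDense]
  refine ⟨(fun p => Prod.fst '' C p) '' T, ?_, hTc.image _, ?_⟩
  · rintro _ ⟨p, hp, rfl⟩
    exact hC2 p (hTS hp)
  · rintro _ ⟨q, hq, rfl⟩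
    obtain ⟨p, hp, hqp⟩ := mem_iUnion₂.1 (hcov hq)
    exact ⟨_, ⟨p, hp, rfl⟩, ⟨q, hqp, rfl⟩⟩

theorem strict_nhds (hP : IsOpen P) {f : ST d → ℝ} (hf : ContDiffOn ℝ ∞ f P) {p : ST d}
    (hp : p ∈ P) {ε : ℝ} (hε : 0 < ε) :
    ∃ W ∈ 𝓝 p, ∀ q ∈ W, ∀ q' ∈ W, |f q - f q' - fderiv ℝ f p (q - q')| ≤ ε * ‖q - q'‖ := by
  have h := (hf.contDiffAt (hP.mem_nhds hp)).hasStrictFDerivAt (by simp)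
  obtain ⟨W, hW, h2⟩ := h.approximates_deriv_on_nhds (c := ⟨ε, hε.le⟩) (Or.inr hε)
  exact ⟨W, hW, fun q hq q' hq' => h2 q hq q' hq'⟩

theorem fderiv_line (f : ST d → ℝ) (p : ST d) (i : Fin d) (s τ : ℝ) :
    fderiv ℝ f p (s • Pi.single i 1, τ) = s * Dd (some i) f p + τ * Dd none f p := by
  have : ((s • Pi.single i 1, τ) : ST d) = s • bas (some i) + τ • bas none := by
    simp [bas]
  rw [this, map_add, map_smul, map_smul]
  rfl

theorem norm_line (i : Fin d) (s τ : ℝ) :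
    ‖((s • Pi.single i 1, τ) : ST d)‖ = max |s| |τ| := by
  rw [Prod.norm_def]
  simp only [norm_smul, Real.norm_eq_abs]
  have : ‖(Pi.single i 1 : Fin d → ℝ)‖ = 1 := by
    rw [Pi.norm_single]; exact norm_one
  rw [this, mul_one]

theorem caseB (hP : IsOpen P) {f : ST d → ℝ} (hf : ContDiffOn ℝ ∞ f P) (i : Fin d) {p : ST d}
    (hp : p ∈ P) (hpt : Dd none f p = 0) (hpi : Dd (some i) f p ≠ 0) :
    ∃ W ∈ 𝓝 p, ∀ U : Set (Fin d → ℝ), IsOpen U → U.Nonempty →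
      (∀ x ∈ U, ∃ t, (x, t) ∈ W ∧ (x, t) ∈ P ∧ f (x, t) = 0 ∧ Dd none f (x, t) = 0 ∧
        Dd (some i) f (x, t) ≠ 0) → False := by
  have hl : 0 < |Dd (some i) f p| := abs_pos.2 hpi
  obtain ⟨W, hW, hWs⟩ := strict_nhds hP hf hp (half_pos hl)
  refine ⟨W, hW, ?_⟩
  rintro U hU ⟨x₀, hx₀⟩ hUx
  set e : Fin d → ℝ := Pi.single i 1 with he
  have hc : Continuous (fun s : ℝ => x₀ + s • e) := by fun_prop
  have hn : (fun s : ℝ => x₀ + s • e) ⁻¹' U ∈ 𝓝 (0 : ℝ) :=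
    (hU.preimage hc).mem_nhds (by simpa using hx₀)
  obtain ⟨η, hη, hball⟩ := Metric.mem_nhds_iff.1 hn
  set D := Metric.ball (0 : ℝ) η with hD
  have hex : ∀ s ∈ D, ∃ t, (x₀ + s • e, t) ∈ W ∧ (x₀ + s • e, t) ∈ P ∧ f (x₀ + s • e, t) = 0 ∧
      Dd none f (x₀ + s • e, t) = 0 ∧ Dd (some i) f (x₀ + s • e, t) ≠ 0 := fun s hs =>
    hUx _ (hball hs)
  choose! t htW htP ht0 htt hti using hex
  have hsub : ∀ s s' : ℝ, ((x₀ + s • e, t s) : ST d) - (x₀ + s' • e, t s') =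
      ((s - s') • e, t s - t s') := by
    intro s s'
    rw [Prod.mk_sub_mk, add_sub_add_left_eq_sub, sub_smul]
  have hlip : ∀ s ∈ D, ∀ s' ∈ D, |s - s'| ≤ |t s - t s'| := by
    intro s hs s' hs'
    have h1 := hWs _ (htW s hs) _ (htW s' hs')
    rw [ht0 s hs, ht0 s' hs', hsub, fderiv_line, norm_line, hpt] at h1
    simp only [sub_self, zero_sub, mul_zero, add_zero, abs_neg, abs_mul] at h1
    by_contra hcon
    push Not at hcon
    rw [max_eq_left hcon.le] at h1
    have : 0 < |s - s'| := (abs_nonneg _).trans_lt hcon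
    nlinarith
  have hinj : InjOn t D := by
    intro s hs s' hs' hst
    have := hlip s hs s' hs'
    rw [hst, sub_self, abs_zero] at this
    exact sub_eq_zero.1 (abs_nonpos_iff.1 this)
  set g := Function.invFunOn t D with hgdef
  have hg : ∀ s ∈ D, g (t s) = s := fun s hs => hinj.leftInvOn_invFunOn hs
  have hder : ∀ τ ∈ t '' D, HasFDerivWithinAt g (0 : ℝ →L[ℝ] ℝ) (t '' D) τ := by
    rintro _ ⟨s, hs, rfl⟩
    refine HasFDerivWithinAt.of_isLittleO ?_
    rw [Asymptotics.isLittleO_iff]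
    intro c hcpos
    have hls : 0 < |Dd (some i) f (x₀ + s • e, t s)| := abs_pos.2 (hti s hs)
    have hfd := (smooth_diffAt hP hf (htP s hs)).hasFDerivAt.isLittleO
    rw [Asymptotics.isLittleO_iff] at hfd
    have hfd := hfd (mul_pos hcpos hls)
    obtain ⟨ρ, hρ, hρb⟩ := Metric.eventually_nhds_iff.1 hfd
    have hnear : {τ | dist τ (t s) < ρ} ∈ 𝓝[t '' D] (t s) :=
      mem_nhdsWithin_of_mem_nhds (Metric.ball_mem_nhds _ hρ)
    filter_upwards [self_mem_nhdsWithin, hnear] with τ hτ hτρ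
    obtain ⟨s', hs', rfl⟩ := hτ
    rw [hg s hs, hg s' hs']
    have hL := hlip s' hs' s hs
    have hnm : ‖((x₀ + s' • e, t s') : ST d) - (x₀ + s • e, t s)‖ = |t s' - t s| := by
      rw [hsub, norm_line, max_eq_right hL]
    have h1 := hρb (y := (x₀ + s' • e, t s')) (by
      rw [dist_eq_norm, hnm]
      exact hτρ)
    rw [hnm, hsub, fderiv_line, ht0 s hs, ht0 s' hs', htt s hs] at h1
    simp only [sub_self, zero_sub, mul_zero, add_zero, norm_neg, Real.norm_eq_abs, abs_mul] at h1
    have h2 : |Dd (some i) f (x₀ + s • e, t s)| * |s' - s| ≤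
      |Dd (some i) f (x₀ + s • e, t s)| * (c * |t s' - t s|) := by linarith
    have h3 := le_of_mul_le_mul_left h2 hls
    simpa using h3
  have hnull := addHaar_image_eq_zero_of_det_fderivWithin_eq_zero (volume : Measure ℝ) hder
    (fun _ _ => by simp)
  have himg : D ⊆ g '' (t '' D) := fun s hs => ⟨t s, ⟨s, hs, rfl⟩, hg s hs⟩
  have h0 := measure_mono_null himg hnull
  exact (Metric.measure_ball_pos volume (0 : ℝ) hη).ne' h0

theorem graph_deriv (hP : IsOpen P) {f : ST d → ℝ} (hf : ContDiffOn ℝ ∞ f P)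
    {U : Set (Fin d → ℝ)} (hU : IsOpen U) {τ : (Fin d → ℝ) → ℝ} (hτP : ∀ x ∈ U, (x, τ x) ∈ P)
    (hfz : ∀ x ∈ U, f (x, τ x) = 0) {C : ℝ} (hlip : ∀ x ∈ U, ∀ y ∈ U, |τ y - τ x| ≤ C * ‖y - x‖)
    {x : Fin d → ℝ} (hx : x ∈ U) (hne : Dd none f (x, τ x) ≠ 0) :
    HasFDerivAt τ (-((Dd none f (x, τ x))⁻¹) •
      ((fderiv ℝ f (x, τ x)).comp (ContinuousLinearMap.inl ℝ (Fin d → ℝ) ℝ))) x := by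
  have hUn : U ∈ 𝓝 x := hU.mem_nhds hx
  have hO : (fun y => τ y - τ x) =O[𝓝 x] fun y => y - x := by
    refine Asymptotics.IsBigO.of_bound C ?_
    filter_upwards [hUn] with y hy
    exact hlip x hx y hy
  have hO2 : (fun y => ((y, τ y) : ST d) - (x, τ x)) =O[𝓝 x] fun y => y - x := by
    simp only [Prod.mk_sub_mk]
    exact (Asymptotics.isBigO_refl _ _).prod_left hO
  have hT : Tendsto (fun y => ((y, τ y) : ST d)) (𝓝 x) (𝓝 (x, τ x)) := by
    have : Tendsto (fun y => ((y, τ y) : ST d) - (x, τ x)) (𝓝 x) (𝓝 0) := by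
      refine hO2.trans_tendsto ?_
      have : Tendsto (fun y : Fin d → ℝ => y - x) (𝓝 x) (𝓝 (x - x)) :=
        (continuous_id.sub continuous_const).tendsto x
      rwa [sub_self] at this
    have h2 := this.add_const ((x, τ x) : ST d)
    simpa using h2
  have hfd := (smooth_diffAt hP hf (hτP x hx)).hasFDerivAt.isLittleO
  have h1 := (hfd.comp_tendsto hT).trans_isBigO hO2
  have h2 := h1.const_mul_left (-((Dd none f (x, τ x))⁻¹))
  refine HasFDerivAt.of_isLittleO ?_
  refine h2.congr' ?_ Filter.EventuallyEq.rfl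
  filter_upwards [hUn] with y hy
  simp only [Function.comp_apply, hfz y hy, hfz x hx]
  have e : ((y, τ y) : ST d) - (x, τ x) =
      ContinuousLinearMap.inl ℝ (Fin d → ℝ) ℝ (y - x) + (τ y - τ x) • bas none := by
    simp [bas]
  rw [e, map_add, map_smul]
  have e2 : fderiv ℝ f (x, τ x) (bas none) = Dd none f (x, τ x) := rfl
  rw [e2]
  simp only [ContinuousLinearMap.smul_apply, ContinuousLinearMap.comp_apply, smul_eq_mul]
  field_simp
  ring

theorem graph_chain (hP : IsOpen P) {g : ST d → ℝ} (hg : ContDiffOn ℝ ∞ g P)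
    {U : Set (Fin d → ℝ)} (hU : IsOpen U) {τ : (Fin d → ℝ) → ℝ} (hτP : ∀ x ∈ U, (x, τ x) ∈ P)
    (hgz : ∀ x ∈ U, g (x, τ x) = 0) {x : Fin d → ℝ} (hx : x ∈ U) {m : (Fin d → ℝ) →L[ℝ] ℝ}
    (hm : HasFDerivAt τ m x) (i : Fin d) :
    Dd (some i) g (x, τ x) + m (Pi.single i 1) * Dd none g (x, τ x) = 0 := by
  have h1 : HasFDerivAt (fun y => ((y, τ y) : ST d)) ((ContinuousLinearMap.id ℝ (Fin d → ℝ)).prod m) x :=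
    (hasFDerivAt_id x).prodMk hm
  have h2 : HasFDerivAt (fun y => g (y, τ y)) _ x :=
    (smooth_diffAt hP hg (hτP x hx)).hasFDerivAt.comp x h1
  have h3 : HasFDerivAt (fun y => g (y, τ y)) (0 : (Fin d → ℝ) →L[ℝ] ℝ) x := by
    refine (hasFDerivAt_const (0 : ℝ) x).congr_of_eventuallyEq ?_
    filter_upwards [hU.mem_nhds hx] with y hy using hgz y hy
  have h4 := congrArg (fun L : (Fin d → ℝ) →L[ℝ] ℝ => L (Pi.single i 1)) (h2.unique h3)
  simp only [ContinuousLinearMap.comp_apply, ContinuousLinearMap.prod_apply] at h4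
  have e : (((ContinuousLinearMap.id ℝ (Fin d → ℝ)) (Pi.single i 1), m (Pi.single i 1)) : ST d) =
      ((1 : ℝ) • Pi.single i 1, m (Pi.single i 1)) := by simp
  rw [e, fderiv_line] at h4
  simpa using h4

theorem caseA (hP : IsOpen P) {V A : ST d → ℝ} {B : Fin d → ST d → ℝ} (hV : ContDiffOn ℝ ∞ V P)
    (hA : ContDiffOn ℝ ∞ A P) (hB : ∀ i, ContDiffOn ℝ ∞ (B i) P)
    (heq : ∀ q ∈ P, Dd none V q = ∑ i, Dd (some i) (Dd (some i) V) q + A q * V q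
      + ∑ i, B i q * Dd (some i) V q) (l : List (Option (Fin d))) {p : ST d} (hp : p ∈ P)
    (hpt : Dd none (Dw l V) p ≠ 0) :
    ∃ W ∈ 𝓝 p, ∀ U : Set (Fin d → ℝ), IsOpen U → U.Nonempty →
      (∀ x ∈ U, ∃ t, (x, t) ∈ W ∧ (x, t) ∈ P ∧ (∀ i, Dd (some i) V (x, t) = 0) ∧
        (∀ l', l'.length < l.length + 1 → Dw l' V (x, t) = 0) ∧
        Dd none (Dw l V) (x, t) ≠ 0) → False := by
  set f := Dw l V with hf
  have hfs : ContDiffOn ℝ ∞ f P := Dw_smooth hP hV l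
  have hl : 0 < |Dd none f p| := abs_pos.2 hpt
  obtain ⟨W, hW, hWs⟩ := strict_nhds hP hfs hp (half_pos hl)
  refine ⟨W, hW, ?_⟩
  rintro U₀ hU₀ ⟨x₀, hx₀⟩ hUx
  obtain ⟨η, hη, hball⟩ := Metric.isOpen_iff.1 hU₀ x₀ hx₀
  set U := Metric.ball x₀ η with hUdef
  have hU : IsOpen U := Metric.isOpen_ball
  have hx₀U : x₀ ∈ U := Metric.mem_ball_self hη
  have hex := fun x (hx : x ∈ U) => hUx x (hball hx)
  choose! τ hτW hτP hτi hτ0 hτt using hex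
  set lam := |Dd none f p| with hlam
  set L := fderiv ℝ f p with hL
  have hfz : ∀ x ∈ U, f (x, τ x) = 0 := fun x hx => hτ0 x hx l (Nat.lt_succ_self _)
  have hlip : ∀ x ∈ U, ∀ y ∈ U, |τ y - τ x| ≤ (‖L‖ + lam / 2) / (lam / 2) * ‖y - x‖ := by
    intro x hx y hy
    have h1 := hWs _ (hτW y hy) _ (hτW x hx)
    rw [hfz x hx, hfz y hy] at h1
    have e : ((y, τ y) : ST d) - (x, τ x) = (y - x, 0) + (τ y - τ x) • bas none := by
      simp [bas]
    have hn : ‖((y, τ y) : ST d) - (x, τ x)‖ ≤ ‖y - x‖ + |τ y - τ x| := by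
      rw [Prod.mk_sub_mk, Prod.norm_def]
      exact max_le (by simp) (by simp)
    have e2 : L (((y, τ y) : ST d) - (x, τ x)) = L (y - x, 0) + (τ y - τ x) * Dd none f p := by
      rw [e, map_add, map_smul]; rfl
    have hb : |L (y - x, 0)| ≤ ‖L‖ * ‖y - x‖ := by
      have := L.le_opNorm ((y - x, 0) : ST d)
      rw [Prod.norm_def] at this
      simpa using this
    rw [e2] at h1
    simp only [sub_self, zero_sub, abs_neg] at h1
    have h2 : |τ y - τ x| * lam ≤ |L (y - x, 0) + (τ y - τ x) * Dd none f p| + |L (y - x, 0)| := by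
      rw [hlam, ← abs_mul]
      have := abs_sub (L (y - x, 0) + (τ y - τ x) * Dd none f p) (L (y - x, 0))
      rwa [add_sub_cancel_left] at this
    have h3 : |L (y - x, 0) + (τ y - τ x) * Dd none f p| ≤ lam / 2 * (‖y - x‖ + |τ y - τ x|) :=
      h1.trans (mul_le_mul_of_nonneg_left hn (by positivity))
    rw [div_mul_eq_mul_div, le_div_iff₀ (by positivity)]
    linarith
  have hder : ∀ x ∈ U, HasFDerivAt τ (0 : (Fin d → ℝ) →L[ℝ] ℝ) x := by
    intro x hx
    have hD := graph_deriv hP hfs hU hτP hfz hlip hx (hτt x hx)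
    set m := (-((Dd none f (x, τ x))⁻¹) •
      ((fderiv ℝ f (x, τ x)).comp (ContinuousLinearMap.inl ℝ (Fin d → ℝ) ℝ))) with hm
    have hchain : ∀ l' : List (Option (Fin d)), l'.length < l.length + 1 → ∀ i,
        Dd (some i) (Dw l' V) (x, τ x) + m (Pi.single i 1) * Dd none (Dw l' V) (x, τ x) = 0 :=
      fun l' hl' i => graph_chain hP (Dw_smooth hP hV l') hU hτP (fun y hy => hτ0 y hy l' hl') hx hD i
    have hmi : ∀ i, m (Pi.single i 1) = 0 := by
      cases l with
      | nil =>
        intro i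
        have h1 := hchain [] (by simp) i
        have h2 := hτi x hx i
        have h3 := hτt x hx
        simp only [hf, Dw] at h1 h3
        rw [h2, zero_add] at h1
        exact (mul_eq_zero.1 h1).resolve_right h3
      | cons o γ =>
        have hlen : γ.length < (o :: γ).length + 1 := by
          rw [List.length_cons]; omega
        have c1 : ∀ i, Dd (some i) (Dd (some i) (Dw γ V)) (x, τ x) +
            m (Pi.single i 1) * Dd none (Dd (some i) (Dw γ V)) (x, τ x) = 0 := fun i =>
          hchain (some i :: γ) (by simp) i
        have c2 : ∀ i, Dd (some i) (Dd none (Dw γ V)) (x, τ x) +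
            m (Pi.single i 1) * Dd none (Dd none (Dw γ V)) (x, τ x) = 0 := fun i =>
          hchain (none :: γ) (by simp) i
        have hγ := Dw_smooth hP hV γ
        have c3 : ∀ i, Dd (some i) (Dd (some i) (Dw γ V)) (x, τ x) =
            m (Pi.single i 1) ^ 2 * Dd none (Dd none (Dw γ V)) (x, τ x) := by
          intro i
          have h1 := c1 i
          have h2 := c2 i
          rw [Dd_comm hP hγ none (some i) (hτP x hx)] at h1
          linear_combination h1 - m (Pi.single i 1) * h2
        -- the equation
        have hsum : ∑ i, Dd (some i) (Dd (some i) (Dw γ V)) (x, τ x) = 0 := by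
          have s1 : ∀ i, ContDiffOn ℝ ∞ (Dd (some i) (Dd (some i) V)) P := fun i =>
            Dd_smooth hP (Dd_smooth hP hV _) _
          have s2 : ContDiffOn ℝ ∞ (fun q => A q * V q) P := hA.mul hV
          have s3 : ∀ i, ContDiffOn ℝ ∞ (fun q => B i q * Dd (some i) V q) P := fun i =>
            (hB i).mul (Dd_smooth hP hV _)
          have s4 : ContDiffOn ℝ ∞ (fun q => ∑ i, Dd (some i) (Dd (some i) V) q) P :=
            ContDiffOn.sum fun i _ => s1 i
          have s5 : ContDiffOn ℝ ∞ (fun q => ∑ i, B i q * Dd (some i) V q) P :=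
            ContDiffOn.sum fun i _ => s3 i
          have hq := hτP x hx
          have E := Dw_congr hP (g := fun q => (∑ i, Dd (some i) (Dd (some i) V) q + A q * V q)
            + ∑ i, B i q * Dd (some i) V q) (fun q hq => heq q hq) γ hq
          have e1 := Dw_add hP (s4.add s2) s5 γ hq
          have e2 := Dw_add hP s4 s2 γ hq
          have e3 := Dw_sum hP Finset.univ _ s1 γ hq
          have e4 := Dw_sum hP Finset.univ _ s3 γ hq
          beta_reduce at e1 e2 e3 e4
          rw [e1, e2, e3, e4] at E
          have hordV : Ord ((o :: γ).length + 1) V (x, τ x) := Ord_iff_Dw.2 (hτ0 x hx)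
          have v1 : Dw γ (Dd none V) (x, τ x) = 0 := by
            rw [Dw_Dd_comm hP hV γ none hq]
            exact hτ0 x hx (none :: γ) (by simp)
          have v2 : Dw γ (fun q => A q * V q) (x, τ x) = 0 :=
            Ord_iff_Dw.1 (Ord_mul hP hq hA hV hordV) γ hlen
          have v3 : ∀ i, Dw γ (fun q => B i q * Dd (some i) V q) (x, τ x) = 0 := fun i =>
            Ord_iff_Dw.1 (Ord_mul hP hq (hB i) (Dd_smooth hP hV _) (hordV.2 (some i))) γ (by simp)
          have v4 : ∀ i, Dw γ (Dd (some i) (Dd (some i) V)) (x, τ x) =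
              Dd (some i) (Dd (some i) (Dw γ V)) (x, τ x) := fun i => by
            rw [Dw_Dd_comm hP (Dd_smooth hP hV _) γ _ hq]
            exact Dd_congr hP (Dw_Dd_comm hP hV γ _) _ hq
          rw [v1, v2, Finset.sum_congr rfl fun i _ => v3 i, Finset.sum_congr rfl fun i _ => v4 i] at E
          simp only [Finset.sum_const_zero, add_zero] at E
          exact E.symm
        rw [Finset.sum_congr rfl fun i _ => c3 i, ← Finset.sum_mul, mul_eq_zero] at hsum
        rcases hsum with h | h
        · rw [Finset.sum_eq_zero_iff_of_nonneg fun i _ => sq_nonneg _] at h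
          intro i
          have := h i (Finset.mem_univ i)
          exact pow_eq_zero_iff two_ne_zero |>.1 this
        · exfalso
          apply hτt x hx
          rw [hf]
          simp only [Dw]
          cases o with
          | none => exact h
          | some i =>
            have h2 := c2 i
            rw [h, mul_zero, add_zero] at h2
            rw [Dd_comm hP hγ none (some i) (hτP x hx)]
            exact h2
    have hm0 : m = 0 := by
      refine ContinuousLinearMap.coe_injective (LinearMap.pi_ext' fun i => ?_)
      ext
      simpa using hmi i
    rw [← hm0]
    exact hD
  have hconst : ∀ x ∈ U, τ x = τ x₀ := by
    intro x hx
    refine (convex_ball x₀ η).is_const_of_fderivWithin_eq_zero (𝕜 := ℝ) (f := τ)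
      (fun y hy => (hder y hy).differentiableAt.differentiableWithinAt) (fun y hy => ?_) hx hx₀U
    rw [fderivWithin_of_isOpen hU hy, (hder y hy).fderiv]
  have hflat := flat_of_slice hP hU (t₀ := τ x₀) (fun x hx => by
    have := hτP x hx; rwa [hconst x hx] at this) hV hA hB heq (fun x hx => by
    have := hτ0 x hx [] (by simp); rwa [hconst x hx] at this) hx₀U (l.length + 2)
  exact hτt x₀ hx₀U (Ord_iff_Dw.1 hflat (none :: l) (by simp))

theorem meagre_main {Ω : Set (Fin d → ℝ)} {I : Set ℝ} (hΩ : IsOpen Ω) (hΩc : IsPreconnected Ω) (hI : IsOpen I)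
    {V A : ST d → ℝ} {B : Fin d → ST d → ℝ} (hV : ContDiffOn ℝ ∞ V (Ω ×ˢ I))
    (hA : ContDiffOn ℝ ∞ A (Ω ×ˢ I)) (hB : ∀ i, ContDiffOn ℝ ∞ (B i) (Ω ×ˢ I))
    (heq : ∀ q ∈ Ω ×ˢ I, Dd none V q = ∑ i, Dd (some i) (Dd (some i) V) q + A q * V q
      + ∑ i, B i q * Dd (some i) V q)
    (hnt : ¬ ∃ t ∈ I, ∀ x ∈ Ω, V (x, t) = 0) :
    IsMeagre (Prod.fst '' {q : ST d | q ∈ Ω ×ˢ I ∧ V q = 0 ∧ ∀ i, Dd (some i) V q = 0}) := by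
  have hP : IsOpen (Ω ×ˢ I) := hΩ.prod hI
  set P := Ω ×ˢ I with hPdef
  -- first family
  have hOo : ∀ (o : Option (Fin d)) (l : List (Option (Fin d))),
      IsOpen (P ∩ (Dd o (Dw l V)) ⁻¹' {0}ᶜ) := fun o l =>
    (Dd_smooth hP (Dw_smooth hP hV l) o).continuousOn.isOpen_inter_preimage hP isOpen_compl_singleton
  have hA1 : ∀ l : List (Option (Fin d)), IsMeagre (Prod.fst '' {q : ST d |
      q ∈ P ∩ (Dd none (Dw l V)) ⁻¹' {0}ᶜ ∧
      ∀ j : Fin d ⊕ {l' : List (Option (Fin d)) // l'.length < l.length + 1},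
        (Sum.elim (fun i => Dd (some i) V) (fun l' => Dw l'.1 V) j : ST d → ℝ) q = 0}) := by
    intro l
    refine meagre_proj (hOo none l) _ ?_ ?_
    · rintro (i | l')
      · exact (Dd_smooth hP hV _).continuousOn.mono inter_subset_left
      · exact (Dw_smooth hP hV _).continuousOn.mono inter_subset_left
    · rintro p ⟨hp, hpt⟩ -
      obtain ⟨W, hW, h⟩ := caseA hP hV hA hB heq l hp hpt
      refine ⟨W, hW, fun U hU hUn hUx => h U hU hUn fun x hx => ?_⟩
      obtain ⟨t, h1, h2, h3⟩ := hUx x hx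
      exact ⟨t, h1, h2.1, fun i => h3 (Sum.inl i), fun l' hl' => h3 (Sum.inr ⟨l', hl'⟩), h2.2⟩
  have hB1 : ∀ (l : List (Option (Fin d))) (i : Fin d), IsMeagre (Prod.fst '' {q : ST d |
      q ∈ P ∩ (Dd (some i) (Dw l V)) ⁻¹' {0}ᶜ ∧
      ∀ j : Bool, ((if j then Dw l V else Dd none (Dw l V)) : ST d → ℝ) q = 0}) := by
    intro l i
    refine meagre_proj (hOo (some i) l)
      (fun j : Bool => ((if j then Dw l V else Dd none (Dw l V)) : ST d → ℝ)) ?_ ?_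
    · rintro (_ | _)
      · exact (Dd_smooth hP (Dw_smooth hP hV l) _).continuousOn.mono inter_subset_left
      · exact (Dw_smooth hP hV _).continuousOn.mono inter_subset_left
    · rintro p ⟨hp, hpt⟩ hz
      obtain ⟨W, hW, h⟩ := caseB hP (Dw_smooth hP hV l) i hp (hz false) hpt
      refine ⟨W, hW, fun U hU hUn hUx => h U hU hUn fun x hx => ?_⟩
      obtain ⟨t, h1, h2, h3⟩ := hUx x hx
      exact ⟨t, h1, h2.1, h3 true, h3 false, h2.2⟩
  refine IsMeagre.mono ?_ ((isMeagre_iUnion hA1).union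
    (isMeagre_iUnion fun l => isMeagre_iUnion (hB1 l)))
  rintro _ ⟨q, ⟨hq, hq0, hqi⟩, rfl⟩
  classical
  have hfin := finite_order hΩ hΩc hI hV hA hB heq hnt hq
  obtain ⟨k, hk, hk1⟩ : ∃ k, Ord (k + 1) V q ∧ ¬ Ord (k + 2) V q := by
    have h1 : Nat.find hfin ≠ 0 := fun h => by
      have := Nat.find_spec hfin
      rw [h] at this
      exact this trivial
    have h2 : Nat.find hfin ≠ 1 := fun h => by
      have := Nat.find_spec hfin
      rw [h] at this
      exact this ⟨hq0, fun _ => trivial⟩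
    refine ⟨Nat.find hfin - 2, ?_, ?_⟩
    · have := Nat.find_min hfin (m := Nat.find hfin - 2 + 1) (by omega)
      exact not_not.1 this
    · have := Nat.find_spec hfin
      rwa [show Nat.find hfin - 2 + 2 = Nat.find hfin by omega]
  rw [Ord_iff_Dw] at hk hk1
  push Not at hk1
  obtain ⟨w, hwl, hw⟩ := hk1
  cases w with
  | nil => exact absurd (hk [] (by simp)) hw
  | cons o l =>
    have hlk : l.length = k := by
      by_contra hne
      apply hw
      apply hk
      simp at hwl ⊢
      omega
    by_cases ht : Dd none (Dw l V) q = 0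
    · cases o with
      | none => exact absurd ht hw
      | some i =>
        refine Or.inr (mem_iUnion.2 ⟨l, mem_iUnion.2 ⟨i, q, ⟨⟨hq, hw⟩, ?_⟩, rfl⟩⟩)
        rintro (_ | _)
        · exact ht
        · exact hk l (by omega)
    · refine Or.inl (mem_iUnion.2 ⟨l, q, ⟨⟨hq, ht⟩, ?_⟩, rfl⟩)
      rintro (i | ⟨l', hl'⟩)
      · exact hqi i
      · exact hk l' (by omega)

end meagre
end Nodal


end

/-- Corollary `coro-nodalset`: for a single solution of a linear
parabolic equation, the set of points `x₀ ∈ Ω` at which no time `t ∈ I` produces a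
singular zero of `v` is generic (residual) in `Ω`. -/
theorem singular_nodal_set_generic_no_parameter
    (d : ℕ) (hd : 2 ≤ d)
    (Ω : Set (Fin d → ℝ)) (hΩo : IsOpen Ω) (hΩc : IsConnected Ω)
    (hΩb : Bornology.IsBounded Ω)
    (I : Set ℝ) (hIo : IsOpen I) (hIc : I.OrdConnected)
    (a : (Fin d → ℝ) → ℝ → ℝ) (b : (Fin d → ℝ) → ℝ → Fin d → ℝ)
    (ha : ContDiffOn ℝ (⊤ : ℕ∞)
      (fun q : (Fin d → ℝ) × ℝ => a q.1 q.2) (Ω ×ˢ I))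
    (hb : ContDiffOn ℝ (⊤ : ℕ∞)
      (fun q : (Fin d → ℝ) × ℝ => b q.1 q.2) (Ω ×ˢ I))
    (hab : ∃ C : ℝ, ∀ x ∈ Ω, ∀ t ∈ I, |a x t| ≤ C ∧ ‖b x t‖ ≤ C)
    (v : (Fin d → ℝ) → ℝ → ℝ)
    (hv_xt : ContDiffOn ℝ (⊤ : ℕ∞) (fun q : (Fin d → ℝ) × ℝ => v q.1 q.2) (Ω ×ˢ I))
    (hv_cont : ContinuousOn (fun q : (Fin d → ℝ) × ℝ => v q.1 q.2) (closure Ω ×ˢ I))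
    (hv_bc : ∀ x ∈ frontier Ω, ∀ t ∈ I, v x t = 0)
    (hv_eq : ∀ x ∈ Ω, ∀ t ∈ I,
      deriv (v x) t
        = lap (fun y => v y t) x + a x t * v x t
          + ∑ i, b x t i * pd i (fun y => v y t) x)
    (hv_nt : ¬ ∃ t ∈ I, ∀ x ∈ Ω, v x t = 0) :
    ∃ F : ℕ → Set (Fin d → ℝ),
      (∀ n, IsOpen (F n) ∧ F n ⊆ Ω ∧ Ω ⊆ closure (F n)) ∧
      (⋂ n, F n) ⊆ {x₀ : Fin d → ℝ |
        ¬ ∃ t ∈ I, v x₀ t = 0 ∧ ∀ i, pd i (fun y => v y t) x₀ = 0} := by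
  have hP : IsOpen (Ω ×ˢ I) := hΩo.prod hIo
  have hdiff : ∀ x ∈ Ω, ∀ t ∈ I,
      DifferentiableAt ℝ (fun q : (Fin d → ℝ) × ℝ => v q.1 q.2) (x, t) := fun x hx t ht =>
    Nodal.smooth_diffAt hP hv_xt ⟨hx, ht⟩
  have hM := Nodal.meagre_main (V := fun q => v q.1 q.2) (A := fun q => a q.1 q.2)
    (B := fun i q => b q.1 q.2 i) hΩo hΩc.isPreconnected hIo hv_xt ha
    (fun i => (contDiffOn_pi.1 hb) i)
    (by
      rintro ⟨x, t⟩ ⟨hx, ht⟩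
      have h := hv_eq x hx t ht
      rw [Nodal.deriv_eq v x t (hdiff x hx t ht), Nodal.lap_eq hP v hv_xt x t ⟨hx, ht⟩] at h
      rw [h]
      congr 1
      exact Finset.sum_congr rfl fun i _ => by rw [Nodal.pd_eq v x t i (hdiff x hx t ht)])
    hv_nt
  obtain ⟨S, hSo, hSd, hSc, hSs⟩ := mem_residual_iff.1 hM
  obtain ⟨G, hG⟩ := (hSc.insert univ).exists_eq_range (insert_nonempty _ _)
  have hGo : ∀ n, IsOpen (G n) ∧ Dense (G n) := by
    intro n
    have : G n ∈ insert univ S := hG ▸ mem_range_self n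
    rcases this with h | h
    · rw [h]; exact ⟨isOpen_univ, dense_univ⟩
    · exact ⟨hSo _ h, hSd _ h⟩
  refine ⟨fun n => Ω ∩ G n, fun n => ⟨hΩo.inter (hGo n).1, inter_subset_left,
    (hGo n).2.open_subset_closure_inter hΩo⟩, ?_⟩
  rintro x hx ⟨t, ht, h0, h1⟩
  rw [mem_iInter] at hx
  have hxΩ : x ∈ Ω := (hx 0).1
  have hxS : x ∈ ⋂₀ S := by
    intro T hT
    have : T ∈ range G := hG ▸ mem_insert_of_mem _ hT
    obtain ⟨n, rfl⟩ := this
    exact (hx n).2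
  exact hSs hxS ⟨(x, t), ⟨⟨hxΩ, ht⟩, h0, fun i => by
    rw [← Nodal.pd_eq v x t i (hdiff x hxΩ t ht)]; exact h1 i⟩, rfl⟩
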